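/- Let Ω = D(0,1) \ ( cl(D(1/2, 1/10)) ∪ cl(D(−1/2, 1/10)) ∪ cl(D(i/2, 1/10)) ∪ cl(D(−i/2, 1/10)) ). Then the automorphism group of Ω consists of exactly the four rotations z ↦ iᵏ z for k ∈ {0, 1, 2, 3}; that is, a map φ : Ω → Ω is an automorphism of Ω if and only if φ(z) = iᵏ z for some k ∈ {0, 1, 2, 3}. -/

import Mathlib

/-- The unit disc with the four closed discs of radius `1/10` centered at
`1/2, -1/2, i/2, -i/2` removed. -/
def FourHoleDomain : Set ℂ :=
  Metric.ball (0:ℂ) 1 \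
    (Metric.closedBall ((1:ℂ)/2) (1/10) ∪
     Metric.closedBall (-(1:ℂ)/2) (1/10) ∪
     Metric.closedBall (Complex.I/2) (1/10) ∪
     Metric.closedBall (-Complex.I/2) (1/10))

open Set Metric Filter Topology MeasureTheory Complex

theorem circleIntegral_cauchyTransform_differentiableOn {f : ℂ → ℂ} {c : ℂ} {r : ℝ} (hr : 0 ≤ r)
    (hf : ContinuousOn f (sphere c r)) :
    DifferentiableOn ℂ (fun z => ∮ ζ in C(c, r), f ζ / (ζ - z)) (sphere c r)ᶜ := by
  intro z hz
  obtain ⟨d, hd, hball⟩ := Metric.isOpen_iff.1 (isClosed_sphere.isOpen_compl) z hz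
  obtain ⟨M, hM⟩ := (isCompact_sphere c r).exists_bound_of_continuousOn hf
  have hmem : ∀ θ, circleMap c r θ ∈ sphere c r := circleMap_mem_sphere c hr
  have hsep : ∀ x ∈ ball z (d / 2), ∀ θ, d / 2 ≤ ‖circleMap c r θ - x‖ := by
    intro x hx θ
    by_contra! h
    refine hball (?_ : circleMap c r θ ∈ ball z d) (hmem θ)
    rw [mem_ball] at hx ⊢
    rw [← dist_eq_norm] at h
    linarith [dist_triangle (circleMap c r θ) x z]
  have hne : ∀ x ∈ ball z (d / 2), ∀ θ, circleMap c r θ - x ≠ 0 := fun x hx θ =>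
    norm_pos_iff.1 (lt_of_lt_of_le (by positivity) (hsep x hx θ))
  have hfc : Continuous fun θ => f (circleMap c r θ) :=
    hf.comp_continuous (continuous_circleMap c r) hmem
  have hcont : ∀ x ∈ ball z (d / 2), Continuous fun θ =>
      deriv (circleMap c r) θ • (f (circleMap c r θ) / (circleMap c r θ - x)) := by
    intro x hx
    simp only [deriv_circleMap]
    exact ((continuous_circleMap 0 r).mul continuous_const).smul
      (hfc.div ((continuous_circleMap c r).sub continuous_const) (hne x hx))
  have hz0 : z ∈ ball z (d / 2) := mem_ball_self (by positivity)
  have hcont' : Continuous fun θ =>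
      deriv (circleMap c r) θ • (f (circleMap c r θ) / (circleMap c r θ - z) ^ 2) := by
    simp only [deriv_circleMap]
    exact ((continuous_circleMap 0 r).mul continuous_const).smul
      (hfc.div (((continuous_circleMap c r).sub continuous_const).pow 2)
        fun θ => pow_ne_zero _ (hne z hz0 θ))
  have key := (intervalIntegral.hasDerivAt_integral_of_dominated_loc_of_deriv_le (μ := volume)
    (a := 0) (b := 2 * Real.pi) (bound := fun _ => r * (M / (d / 2) ^ 2))
    (F := fun x θ => deriv (circleMap c r) θ • (f (circleMap c r θ) / (circleMap c r θ - x)))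
    (F' := fun x θ => deriv (circleMap c r) θ • (f (circleMap c r θ) / (circleMap c r θ - x) ^ 2))
    (ball_mem_nhds z (by positivity : 0 < d / 2)) ?_ ?_ ?_ ?_ ?_ ?_).2
  · exact key.differentiableAt.differentiableWithinAt
  · filter_upwards [ball_mem_nhds z (by positivity : 0 < d / 2)] with x hx
    exact (hcont x hx).aestronglyMeasurable
  · exact (hcont z hz0).intervalIntegrable _ _
  · exact hcont'.aestronglyMeasurable
  · refine ae_of_all _ fun θ _ x hx => ?_
    have h1 := hM _ (hmem θ)
    have h2 := hsep x hx θ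
    rw [norm_smul, deriv_circleMap, norm_mul, norm_circleMap_zero, abs_of_nonneg hr, norm_I,
      mul_one, norm_div, norm_pow]
    have : 0 ≤ M := (norm_nonneg _).trans h1
    gcongr
  · exact intervalIntegrable_const
  · refine ae_of_all _ fun θ _ x hx => ?_
    have h := ((hasDerivAt_id x).const_sub (circleMap c r θ)).inv (hne x hx θ)
    have h2 := (h.const_mul (f (circleMap c r θ))).const_smul (deriv (circleMap c r) θ)
    convert! h2 using 1
    simp [div_eq_mul_inv]

theorem circleIntegral_eq_of_differentiableOn_annulus {f : ℂ → ℂ} {c : ℂ} {r R : ℝ} {U : Set ℂ}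
    (hr : 0 < r) (hrR : r ≤ R) (hU : IsOpen U) (hsub : closedBall c R \ ball c r ⊆ U)
    (hf : DifferentiableOn ℂ f U) :
    (∮ ζ in C(c, R), f ζ) = ∮ ζ in C(c, r), f ζ := by
  refine circleIntegral_eq_of_differentiable_on_annulus_off_countable hr hrR countable_empty
    (hf.continuousOn.mono hsub) fun z hz => hf.differentiableAt (hU.mem_nhds (hsub ?_))
  exact ⟨ball_subset_closedBall hz.1.1, fun h => hz.1.2 (ball_subset_closedBall h)⟩

theorem circleIntegral_eq_zero_of_differentiableOn {g : ℂ → ℂ} {c : ℂ} {r : ℝ} {U : Set ℂ} (hr : 0 ≤ r)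
    (hU : IsOpen U) (hsub : closedBall c r ⊆ U) (hg : DifferentiableOn ℂ g U) :
    (∮ ζ in C(c, r), g ζ) = 0 :=
  circleIntegral_eq_zero_of_differentiable_on_off_countable hr countable_empty
    (hg.continuousOn.mono hsub) fun _ hz =>
      hg.differentiableAt (hU.mem_nhds (hsub (ball_subset_closedBall hz.1)))

theorem circleIntegral_const_div_sub_of_notMem (w : ℂ) {c z : ℂ} {r : ℝ} (hr : 0 ≤ r)
    (hz : z ∉ closedBall c r) : (∮ ζ in C(c, r), w / (ζ - z)) = 0 := by
  refine circleIntegral_eq_zero_of_differentiableOn hr (isOpen_compl_singleton (x := z)) ?_ ?_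
  · intro ζ hζ h
    exact hz (by simpa using h ▸ hζ)
  · intro ζ hζ
    exact ((differentiableAt_const w).div (differentiableAt_id.sub_const z)
      (sub_ne_zero.2 hζ)).differentiableWithinAt

theorem circleIntegral_const_div_sub_of_mem (w : ℂ) {c z : ℂ} {r : ℝ}
    (hz : z ∈ ball c r) : (∮ ζ in C(c, r), w / (ζ - z)) = 2 * Real.pi * I * w := by
  have := circleIntegral.integral_const_mul w (fun ζ => (ζ - z)⁻¹) c r
  rw [circleIntegral.integral_sub_inv_of_mem_ball hz] at this
  simp only [div_eq_mul_inv]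
  rw [this]; ring

theorem cauchy_formula_annulus {f : ℂ → ℂ} {c z : ℂ} {r R : ℝ} {U : Set ℂ} (hr : 0 < r)
    (hU : IsOpen U) (hsub : closedBall c R \ ball c r ⊆ U) (hf : DifferentiableOn ℂ f U)
    (hz : z ∈ ball c R \ closedBall c r) :
    (∮ ζ in C(c, R), f ζ / (ζ - z)) - (∮ ζ in C(c, r), f ζ / (ζ - z)) =
      2 * Real.pi * I * f z := by
  have hzR := mem_ball.1 hz.1
  have hzr : r < dist z c := not_le.1 hz.2
  have hR : 0 < R := hr.trans (hzr.trans hzR)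
  have hzU : z ∈ U := hsub ⟨ball_subset_closedBall hz.1, fun h => hz.2 (ball_subset_closedBall h)⟩
  have hd : DifferentiableOn ℂ (dslope f z) U :=
    (differentiableOn_dslope (hU.mem_nhds hzU)).2 hf
  have h0 := circleIntegral_eq_of_differentiableOn_annulus hr (hzr.trans hzR).le hU hsub hd
  have hs : ∀ ρ : ℝ, 0 < ρ → sphere c ρ ⊆ U → z ∉ sphere c ρ →
      (∮ ζ in C(c, ρ), dslope f z ζ) =
        (∮ ζ in C(c, ρ), f ζ / (ζ - z)) - ∮ ζ in C(c, ρ), f z / (ζ - z) := by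
    intro ρ hρ hsU hzs
    have hne : ∀ ζ ∈ sphere c ρ, ζ - z ≠ 0 := fun ζ hζ h => hzs (sub_eq_zero.1 h ▸ hζ)
    rw [← circleIntegral.integral_sub]
    · refine circleIntegral.integral_congr hρ.le fun ζ hζ => ?_
      rw [dslope_of_ne _ (sub_ne_zero.1 (hne ζ hζ)), slope_def_field]
      simp only [sub_div]
    · exact ((hf.continuousOn.mono hsU).div (by fun_prop) hne).circleIntegrable hρ.le
    · exact (continuousOn_const.div (by fun_prop) hne).circleIntegrable hρ.le
  have hsr : sphere c r ⊆ U := fun ζ hζ => hsub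
    ⟨mem_closedBall.2 ((mem_sphere.1 hζ).le.trans (hzr.trans hzR).le),
      fun h => (mem_ball.1 h).ne (mem_sphere.1 hζ)⟩
  have hsR : sphere c R ⊆ U := fun ζ hζ => hsub
    ⟨sphere_subset_closedBall hζ, fun h =>
      ((mem_ball.1 h).trans (hzr.trans hzR)).ne (mem_sphere.1 hζ)⟩
  rw [hs R hR hsR fun h => hzR.ne (mem_sphere.1 h), hs r hr hsr fun h => hzr.ne' (mem_sphere.1 h),
    circleIntegral_const_div_sub_of_mem _ hz.1, circleIntegral_const_div_sub_of_notMem _ hr.le hz.2]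
    at h0
  linear_combination h0

theorem circleIntegral_swap {F : ℂ → ℂ → ℂ} {c d : ℂ} {r s : ℝ} (hr : 0 ≤ r) (hs : 0 ≤ s)
    (hF : ContinuousOn (Function.uncurry F) (sphere c r ×ˢ sphere d s)) :
    (∮ z in C(c, r), ∮ ζ in C(d, s), F z ζ) = ∮ ζ in C(d, s), ∮ z in C(c, r), F z ζ := by
  simp only [circleIntegral, ← intervalIntegral.integral_smul]
  rw [intervalIntegral_intervalIntegral_swap]
  · simp only [smul_smul, mul_comm]
  · have hc : Continuous fun p : ℝ × ℝ => F (circleMap c r p.1) (circleMap d s p.2) :=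
      hF.comp_continuous (f := fun p : ℝ × ℝ => (circleMap c r p.1, circleMap d s p.2))
        (by fun_prop) fun p => ⟨circleMap_mem_sphere c hr _, circleMap_mem_sphere d hs _⟩
    have : Continuous (Function.uncurry fun x y : ℝ => deriv (circleMap c r) x •
        deriv (circleMap d s) y • F (circleMap c r x) (circleMap d s y)) := by
      simp only [deriv_circleMap, Function.uncurry_def]
      exact (((continuous_circleMap 0 r).comp continuous_fst).mul continuous_const).smul
        ((((continuous_circleMap 0 s).comp continuous_snd).mul continuous_const).smul hc)
    refine (this.continuousOn.integrableOn_compact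
      (isCompact_uIcc.prod isCompact_uIcc)).mono_set
      (prod_mono uIoc_subset_uIcc uIoc_subset_uIcc)

theorem exists_annulus_subset_of_sphere_subset {c : ℂ} {r : ℝ} {U : Set ℂ} (hr : 0 < r)
    (hU : IsOpen U) (h : sphere c r ⊆ U) : ∃ R > r, closedBall c R \ ball c r ⊆ U := by
  obtain ⟨δ, hδ, hδU⟩ := (isCompact_sphere c r).exists_cthickening_subset_open hU h
  refine ⟨r + δ, by linarith, fun z hz => hδU ?_⟩
  have h1 : ‖z - c‖ ≤ r + δ := by simpa [dist_eq_norm] using hz.1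
  have h2 : r ≤ ‖z - c‖ := by simpa [dist_eq_norm] using hz.2
  have h3 : (0 : ℝ) < ‖z - c‖ := hr.trans_le h2
  have hne : (‖z - c‖ : ℂ) ≠ 0 := by exact_mod_cast h3.ne'
  refine mem_cthickening_of_dist_le z (c + (r / ‖z - c‖ : ℝ) * (z - c)) δ _ ?_ ?_
  · rw [mem_sphere, dist_eq_norm, add_sub_cancel_left, norm_mul, norm_real, Real.norm_eq_abs,
      abs_of_nonneg (by positivity), div_mul_cancel₀ _ h3.ne']
  · have : z - (c + (r / ‖z - c‖ : ℝ) * (z - c)) = ((‖z - c‖ - r) / ‖z - c‖ : ℝ) * (z - c) := by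
      push_cast
      field_simp
      ring
    rw [dist_eq_norm, this, norm_mul, norm_real, Real.norm_eq_abs,
      abs_of_nonneg (div_nonneg (by linarith) h3.le), div_mul_cancel₀ _ h3.ne']
    linarith

/-- **Cauchy's theorem for a disc with finitely many round holes.** -/
theorem circleIntegral_eq_sum_of_differentiableOn {ι : Type*} [DecidableEq ι] {a : ℂ} {t : ℝ}
    (ht : 0 ≤ t) (c : ι → ℂ) (r : ι → ℝ) (s : Finset ι) (hr : ∀ j ∈ s, 0 < r j)
    (hin : ∀ j ∈ s, closedBall (c j) (r j) ⊆ ball a t)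
    (hdisj : ∀ j ∈ s, ∀ k ∈ s, j ≠ k →
      Disjoint (closedBall (c j) (r j)) (closedBall (c k) (r k)))
    {f : ℂ → ℂ} {U : Set ℂ} (hU : IsOpen U) (hf : DifferentiableOn ℂ f U)
    (hsub : closedBall a t \ ⋃ j ∈ s, ball (c j) (r j) ⊆ U) :
    (∮ z in C(a, t), f z) = ∑ j ∈ s, ∮ z in C(c j, r j), f z := by
  induction s using Finset.induction_on generalizing f U with
  | empty =>
    simp only [Finset.notMem_empty, iUnion_false, iUnion_empty, sdiff_empty] at hsub
    simpa using circleIntegral_eq_zero_of_differentiableOn ht hU hsub hf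
  | insert i s his ih =>
    have hmi := Finset.mem_insert_self i s
    have hms : ∀ {k}, k ∈ s → k ∈ insert i s := fun h => Finset.mem_insert_of_mem h
    have hri := hr i hmi
    have hik : ∀ k ∈ s, i ≠ k := fun k hk h => his (h ▸ hk)
    have hsphere : sphere (c i) (r i) ⊆ U := by
      refine fun z hz => hsub ⟨ball_subset_closedBall
        (hin i hmi (sphere_subset_closedBall hz)), fun h => ?_⟩
      simp only [mem_iUnion, exists_prop] at h
      obtain ⟨k, hk, hzk⟩ := h
      rcases Finset.mem_insert.1 hk with rfl | hk'
      · exact (mem_ball.1 hzk).ne (mem_sphere.1 hz)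
      · exact (hdisj i hmi k hk (hik k hk')).le_bot
          ⟨sphere_subset_closedBall hz, ball_subset_closedBall hzk⟩
    obtain ⟨R, hR, hRU⟩ := exists_annulus_subset_of_sphere_subset hri hU hsphere
    set A : ℂ → ℂ := fun z => ∮ ζ in C(c i, R), f ζ / (ζ - z) with hA
    set B : ℂ → ℂ := fun z => ∮ ζ in C(c i, r i), f ζ / (ζ - z) with hB
    have hAd : DifferentiableOn ℂ A (ball (c i) R) := by
      refine (circleIntegral_cauchyTransform_differentiableOn (hri.le.trans hR.le)
        (hf.continuousOn.mono fun z hz => hRU ⟨sphere_subset_closedBall hz, fun h =>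
          ((mem_ball.1 h).trans hR).ne (mem_sphere.1 hz)⟩)).mono ?_
      exact fun z hz h => (mem_ball.1 hz).ne (mem_sphere.1 h)
    have hBd : DifferentiableOn ℂ B (closedBall (c i) (r i))ᶜ :=
      (circleIntegral_cauchyTransform_differentiableOn hri.le
        (hf.continuousOn.mono hsphere)).mono
          (compl_subset_compl.2 sphere_subset_closedBall)
    have hpi : (2 * Real.pi * I : ℂ) ≠ 0 := two_pi_I_ne_zero
    classical
    set P : ℂ → ℂ := fun z => if z ∈ closedBall (c i) (r i) then (2 * Real.pi * I)⁻¹ * A z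
      else f z + (2 * Real.pi * I)⁻¹ * B z with hP
    have hPA : EqOn P (fun z => (2 * Real.pi * I)⁻¹ * A z) (ball (c i) R) := by
      intro z hz
      by_cases h : z ∈ closedBall (c i) (r i)
      · simp only [hP, if_pos h]
      · have := cauchy_formula_annulus hri hU hRU hf ⟨hz, h⟩
        simp only [hP, if_neg h, hA, hB]
        field_simp
        linear_combination -this
    have hPB : ∀ z ∉ closedBall (c i) (r i), P z = f z + (2 * Real.pi * I)⁻¹ * B z :=
      fun z hz => by simp only [hP, if_neg hz]
    have hV : IsOpen (U \ closedBall (c i) (r i)) := hU.sdiff isClosed_closedBall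
    have hPd : DifferentiableOn ℂ P (ball (c i) R ∪ U \ closedBall (c i) (r i)) := by
      refine DifferentiableOn.union_of_isOpen ((hAd.const_mul _).congr hPA) ?_ isOpen_ball hV
      refine DifferentiableOn.congr ((hf.mono sdiff_subset).add
        ((hBd.mono fun z hz => hz.2).const_mul (2 * Real.pi * I)⁻¹)) fun z hz => hPB z hz.2
    have key := ih (fun j hj => hr j (hms hj)) (fun j hj => hin j (hms hj))
      (fun j hj k hk => hdisj j (hms hj) k (hms hk)) (isOpen_ball.union hV) hPd (by
        intro z hz
        by_cases h : z ∈ closedBall (c i) (r i)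
        · exact Or.inl (closedBall_subset_ball hR h)
        · refine Or.inr ⟨hsub ⟨hz.1, fun h' => ?_⟩, h⟩
          simp only [mem_iUnion, exists_prop] at h'
          obtain ⟨k, hk, hzk⟩ := h'
          rcases Finset.mem_insert.1 hk with rfl | hk'
          · exact h (ball_subset_closedBall hzk)
          · exact hz.2 (mem_biUnion hk' hzk))
    have hsplit : ∀ b ρ, 0 ≤ ρ → sphere b ρ ⊆ U \ closedBall (c i) (r i) →
        (∮ z in C(b, ρ), P z) =
          (∮ z in C(b, ρ), f z) + (2 * Real.pi * I)⁻¹ * ∮ z in C(b, ρ), B z := by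
      intro b ρ hρ hs
      rw [circleIntegral.integral_congr hρ fun z hz => hPB z (hs hz).2, ← circleIntegral.integral_const_mul,
        ← circleIntegral.integral_add]
      · exact (hf.continuousOn.mono fun z hz => (hs hz).1).circleIntegrable hρ
      · exact ((hBd.continuousOn.mono fun z hz => (hs hz).2).const_smul
          (2 * Real.pi * I : ℂ)⁻¹).circleIntegrable hρ
    have hout : sphere a t ⊆ U \ closedBall (c i) (r i) := by
      refine fun z hz => ⟨hsub ⟨sphere_subset_closedBall hz, fun h => ?_⟩,
        fun h => (mem_ball.1 (hin i hmi h)).ne (mem_sphere.1 hz)⟩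
      simp only [mem_iUnion, exists_prop] at h
      obtain ⟨k, hk, hzk⟩ := h
      exact (mem_ball.1 (hin k hk (ball_subset_closedBall hzk))).ne (mem_sphere.1 hz)
    have hBout : (∮ z in C(a, t), B z) = -(2 * Real.pi * I) * ∮ ζ in C(c i, r i), f ζ := by
      simp only [hB]
      rw [circleIntegral_swap ht hri.le]
      · rw [← circleIntegral.integral_const_mul]
        refine circleIntegral.integral_congr hri.le fun ζ hζ => ?_
        have := circleIntegral_const_div_sub_of_mem (-f ζ)
          (hin i hmi (sphere_subset_closedBall hζ))
        rw [neg_mul, ← mul_neg, ← this]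
        congr 1
        ext z
        rw [← neg_sub z ζ, div_neg, neg_div]
      · refine ContinuousOn.div ?_ (by fun_prop) ?_
        · exact (hf.continuousOn.mono hsphere).comp continuousOn_snd fun p hp => hp.2
        · rintro ⟨z, ζ⟩ ⟨hz, hζ⟩ h
          rw [sub_eq_zero] at h
          exact (hout hz).2 (sphere_subset_closedBall (h ▸ hζ))
    have hrest : ∀ k ∈ s, (∮ z in C(c k, r k), P z) = ∮ z in C(c k, r k), f z := by
      intro k hk
      have hkd := hdisj i hmi k (hms hk) (hik k hk)
      have hkc : closedBall (c k) (r k) ⊆ (closedBall (c i) (r i))ᶜ :=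
        hkd.symm.subset_compl_right
      rw [hsplit _ _ (hr k (hms hk)).le, circleIntegral_eq_zero_of_differentiableOn
        (hr k (hms hk)).le isClosed_closedBall.isOpen_compl hkc hBd, mul_zero, add_zero]
      refine fun z hz => ⟨hsub ⟨ball_subset_closedBall
        (hin k (hms hk) (sphere_subset_closedBall hz)), fun h => ?_⟩,
        hkc (sphere_subset_closedBall hz)⟩
      simp only [mem_iUnion, exists_prop] at h
      obtain ⟨l, hl, hzl⟩ := h
      rcases eq_or_ne k l with rfl | hkl
      · exact (mem_ball.1 hzl).ne (mem_sphere.1 hz)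
      · exact (hdisj k (hms hk) l hl hkl).le_bot
          ⟨sphere_subset_closedBall hz, ball_subset_closedBall hzl⟩
    rw [hsplit a t ht hout, hBout, Finset.sum_congr rfl hrest] at key
    rw [Finset.sum_insert his, ← key]
    field_simp
    ring

/-- Inversion in the circle of center `c` and radius `r`. -/
noncomputable def circleInversion (c : ℂ) (r : ℝ) (z : ℂ) : ℂ :=
  c + (r ^ 2 / normSq (z - c) : ℝ) * (z - c)

/-- The signed power of the point `z` with respect to a circle, divided by the signed radius. -/
noncomputable def signedPower (c : ℂ) (r : ℝ) (z : ℂ) : ℝ := (normSq (z - c) - r ^ 2) / r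

theorem circleInversion_eq_div (c : ℂ) (r : ℝ) (z : ℂ) :
    circleInversion c r z = c + r ^ 2 / (starRingEnd ℂ) (z - c) := by
  unfold circleInversion
  by_cases h : z - c = 0
  · simp [h]
  have h' : (starRingEnd ℂ) (z - c) ≠ 0 := (map_ne_zero _).2 h
  have : (normSq (z - c) : ℂ) = (z - c) * (starRingEnd ℂ) (z - c) := (mul_conj _).symm
  push_cast
  rw [this]
  field_simp

theorem normSq_circleInversion_sub {c z : ℂ} {r : ℝ} (hz : z ≠ c) :
    normSq (circleInversion c r z - c) = r ^ 4 / normSq (z - c) := by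
  have h : normSq (z - c) ≠ 0 := by simpa [sub_eq_zero] using hz
  simp only [circleInversion, add_sub_cancel_left, normSq_mul, normSq_ofReal]
  field_simp

theorem circleInversion_ne_center {c z : ℂ} {r : ℝ} (hr : r ≠ 0) (hz : z ≠ c) :
    circleInversion c r z ≠ c := by
  have h : normSq (z - c) ≠ 0 := by simpa [sub_eq_zero] using hz
  intro h'
  have := normSq_circleInversion_sub (r := r) hz
  rw [h'] at this
  simp only [sub_self, map_zero] at this
  exact absurd this.symm (by positivity)

theorem circleInversion_circleInversion {c z : ℂ} {r : ℝ} (hr : r ≠ 0) (hz : z ≠ c) :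
    circleInversion c r (circleInversion c r z) = z := by
  have h : normSq (z - c) ≠ 0 := by simpa [sub_eq_zero] using hz
  have h' : (normSq (z - c) : ℂ) ≠ 0 := by exact_mod_cast h
  have hr' : (r : ℂ) ≠ 0 := by exact_mod_cast hr
  have h1 := normSq_circleInversion_sub (r := r) hz
  conv_lhs => unfold circleInversion
  change c + (r ^ 2 / normSq (circleInversion c r z - c) : ℝ) * (circleInversion c r z - c) = z
  rw [h1]
  simp only [circleInversion, add_sub_cancel_left]
  push_cast
  field_simp
  ring

theorem signedPower_circleInversion {a c z : ℂ} {r ρ P : ℝ} (hr : r ≠ 0) (hρ : ρ ≠ 0)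
    (hP : P = normSq (a - c) - ρ ^ 2) (hP0 : P ≠ 0) (hz : z ≠ c) :
    signedPower (c + (r ^ 2 / P : ℝ) * (a - c)) (r ^ 2 * ρ / P) (circleInversion c r z) =
      r ^ 2 / normSq (z - c) * signedPower a ρ z := by
  obtain ⟨N, hN⟩ : ∃ N, N = normSq (z - c) := ⟨_, rfl⟩
  have h : N ≠ 0 := by rw [hN]; simpa [sub_eq_zero] using hz
  simp only [signedPower, circleInversion]
  rw [← hN]
  have e : c + (r ^ 2 / N : ℝ) * (z - c) - (c + (r ^ 2 / P : ℝ) * (a - c)) =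
    (r ^ 2 / N : ℝ) * (z - c) - (r ^ 2 / P : ℝ) * (a - c) := by ring
  have e2 : z - a = (z - c) - (a - c) := by ring
  rw [e, e2]
  generalize z - c = w at hN ⊢
  generalize a - c = b at hP ⊢
  obtain ⟨x, y⟩ := w
  obtain ⟨u, v⟩ := b
  simp only [normSq_apply, sub_re, sub_im, mul_re, mul_im, ofReal_re, ofReal_im] at hN hP ⊢
  have hx : x * x = N - y * y := by linarith
  have hu : u * u = P + ρ ^ 2 - v * v := by linarith
  field_simp
  ring_nf
  have hx2 : x ^ 2 = N - y ^ 2 := by linarith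
  have hu2 : u ^ 2 = P + ρ ^ 2 - v ^ 2 := by linarith
  simp only [hx2, hu2]
  ring

theorem signedPower_inverted_center {a c : ℂ} {r ρ P : ℝ} (hr : r ≠ 0) (hρ : ρ ≠ 0)
    (hP : P = normSq (a - c) - ρ ^ 2) (hP0 : P ≠ 0) :
    signedPower (c + (r ^ 2 / P : ℝ) * (a - c)) (r ^ 2 * ρ / P) c = r ^ 2 / ρ := by
  have e : c - (c + (r ^ 2 / P : ℝ) * (a - c)) = -((r ^ 2 / P : ℝ) * (a - c)) := by ring
  simp only [signedPower, e, normSq_neg, normSq_mul, normSq_ofReal]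
  have : normSq (a - c) = P + ρ ^ 2 := by linarith
  rw [this]
  field_simp
  ring

/-- The inversive product of two circles with signed radii. -/
noncomputable def inversiveProduct (a : ℂ) (ρ : ℝ) (b : ℂ) (τ : ℝ) : ℝ :=
  (normSq (a - b) - ρ ^ 2 - τ ^ 2) / (ρ * τ)

theorem inversiveProduct_inverted {a b c : ℂ} {r ρ τ P T : ℝ} (hr : r ≠ 0) (hρ : ρ ≠ 0)
    (hτ : τ ≠ 0) (hP : P = normSq (a - c) - ρ ^ 2) (hP0 : P ≠ 0)
    (hT : T = normSq (b - c) - τ ^ 2) (hT0 : T ≠ 0) :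
    inversiveProduct (c + (r ^ 2 / P : ℝ) * (a - c)) (r ^ 2 * ρ / P)
      (c + (r ^ 2 / T : ℝ) * (b - c)) (r ^ 2 * τ / T) = inversiveProduct a ρ b τ := by
  have e : c + (r ^ 2 / P : ℝ) * (a - c) - (c + (r ^ 2 / T : ℝ) * (b - c)) =
    (r ^ 2 / P : ℝ) * (a - c) - (r ^ 2 / T : ℝ) * (b - c) := by ring
  have e2 : a - b = (a - c) - (b - c) := by ring
  simp only [inversiveProduct]
  rw [e, e2]
  generalize b - c = w at hT ⊢
  generalize a - c = d at hP ⊢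
  obtain ⟨x, y⟩ := w
  obtain ⟨u, v⟩ := d
  simp only [normSq_apply, sub_re, sub_im, mul_re, mul_im, ofReal_re, ofReal_im] at hT hP ⊢
  have hx : x ^ 2 = T + τ ^ 2 - y ^ 2 := by linarith
  have hu : u ^ 2 = P + ρ ^ 2 - v ^ 2 := by linarith
  field_simp
  ring_nf
  simp only [hx, hu]
  ring

/-- Five well separated circles: the outer one, of index `o` and negative radius, encloses the
four others, which have positive radii. -/
structure CircleConfig (o : Fin 5) where
  center : Fin 5 → ℂ
  radius : Fin 5 → ℝ
  radius_outer_neg : radius o < 0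
  radius_pos : ∀ j, j ≠ o → 0 < radius j
  radius_le : ∀ j, j ≠ o → 3 * radius j ≤ -radius o
  separated : ∀ j k, j ≠ k →
    7.6 ≤ inversiveProduct (center j) (radius j) (center k) (radius k)

namespace CircleConfig

variable {o : Fin 5} (S : CircleConfig o)

noncomputable def power (j : Fin 5) (z : ℂ) : ℝ := signedPower (S.center j) (S.radius j) z

/-- The region bounded by the five circles. -/
def dom : Set ℂ := {z | ∀ j, 0 < S.power j z}

/-- The filter of points of the region that approach the circle `j`. -/
noncomputable def boundaryEnd (j : Fin 5) : Filter ℂ := comap (S.power j) (𝓝 0) ⊓ 𝓟 S.dom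

def outerRadius : ℝ := -S.radius o

theorem outerRadius_pos : 0 < S.outerRadius := neg_pos.2 S.radius_outer_neg

theorem radius_ne_zero (j : Fin 5) : S.radius j ≠ 0 := by
  by_cases h : j = o
  · exact h ▸ S.radius_outer_neg.ne
  · exact (S.radius_pos j h).ne'

theorem normSq_center_sub_center {j k : Fin 5} (hj : j ≠ o) (hk : k ≠ o) (hjk : j ≠ k) :
    S.radius j ^ 2 + S.radius k ^ 2 + 7.6 * (S.radius j * S.radius k) ≤
      normSq (S.center j - S.center k) := by
  have h := S.separated j k hjk
  have h1 := mul_pos (S.radius_pos j hj) (S.radius_pos k hk)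
  rw [inversiveProduct, le_div_iff₀ h1] at h
  linarith

theorem normSq_center_sub_outer {j : Fin 5} (hj : j ≠ o) :
    normSq (S.center j - S.center o) ≤
      S.radius j ^ 2 + S.outerRadius ^ 2 - 7.6 * (S.radius j * S.outerRadius) := by
  have h := S.separated j o hj
  have h1 : S.radius j * S.radius o < 0 :=
    mul_neg_of_pos_of_neg (S.radius_pos j hj) S.radius_outer_neg
  rw [inversiveProduct, le_div_iff_of_neg h1] at h
  rw [outerRadius]
  linarith

theorem radius_add_radius_lt {j k : Fin 5} (hj : j ≠ o) (hk : k ≠ o) (hjk : j ≠ k) :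
    S.radius j + S.radius k < ‖S.center j - S.center k‖ := by
  have h := S.normSq_center_sub_center hj hk hjk
  rw [normSq_eq_norm_sq] at h
  have h1 := mul_pos (S.radius_pos j hj) (S.radius_pos k hk)
  refine lt_of_pow_lt_pow_left₀ 2 (norm_nonneg _) ?_
  linarith

theorem norm_center_sub_add_radius_lt {j : Fin 5} (hj : j ≠ o) :
    ‖S.center j - S.center o‖ + S.radius j < S.outerRadius := by
  have h := S.normSq_center_sub_outer hj
  rw [normSq_eq_norm_sq] at h
  have h0 := S.radius_pos j hj
  have h1 := mul_pos h0 S.outerRadius_pos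
  have h2 : 3 * S.radius j ≤ S.outerRadius := S.radius_le j hj
  have : ‖S.center j - S.center o‖ < S.outerRadius - S.radius j :=
    lt_of_pow_lt_pow_left₀ 2 (by linarith) (by linarith)
  linarith

theorem power_outer_pos_iff {z : ℂ} : 0 < S.power o z ↔ ‖z - S.center o‖ < S.outerRadius := by
  have h := S.radius_outer_neg
  rw [power, signedPower, div_pos_iff]
  have h1 : S.radius o ^ 2 = S.outerRadius ^ 2 := by rw [outerRadius]; ring
  rw [normSq_eq_norm_sq, h1, ← pow_lt_pow_iff_left₀ (norm_nonneg _) S.outerRadius_pos.le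
    two_ne_zero]
  constructor
  · rintro (h | h) <;> linarith [h.1, h.2]
  · exact fun h' => Or.inr ⟨by linarith, h⟩

theorem power_pos_iff {j : Fin 5} (hj : j ≠ o) {z : ℂ} :
    0 < S.power j z ↔ S.radius j < ‖z - S.center j‖ := by
  have h := S.radius_pos j hj
  rw [power, signedPower, div_pos_iff_of_pos_right h, normSq_eq_norm_sq,
    ← pow_lt_pow_iff_left₀ h.le (norm_nonneg _) two_ne_zero, sub_pos]

theorem mem_dom_iff {z : ℂ} : z ∈ S.dom ↔
    ‖z - S.center o‖ < S.outerRadius ∧ ∀ j, j ≠ o → S.radius j < ‖z - S.center j‖ := by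
  constructor
  · exact fun h => ⟨S.power_outer_pos_iff.1 (h o), fun j hj => (S.power_pos_iff hj).1 (h j)⟩
  · rintro ⟨h1, h2⟩ j
    by_cases hj : j = o
    · exact hj ▸ S.power_outer_pos_iff.2 h1
    · exact (S.power_pos_iff hj).2 (h2 j hj)

theorem continuous_power (j : Fin 5) : Continuous (S.power j) := by
  unfold power signedPower
  exact (((continuous_normSq.comp (continuous_id.sub continuous_const)).sub
    continuous_const).div_const _)

theorem isOpen_dom : IsOpen S.dom := by
  have : S.dom = ⋂ j, {z | 0 < S.power j z} := by ext; simp [dom]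
  rw [this]
  exact isOpen_iInter_of_finite fun j => isOpen_lt continuous_const (S.continuous_power j)

/-- The power of the center of the circle `i` with respect to the circle `j`. -/
noncomputable def centerPower (i j : Fin 5) : ℝ :=
  normSq (S.center j - S.center i) - S.radius j ^ 2

variable {i : Fin 5} (hi : i ≠ o)

theorem centerPower_self : S.centerPower i i = -S.radius i ^ 2 := by simp [centerPower]

include hi

theorem centerPower_outer_le :
    S.centerPower i o ≤ S.radius i ^ 2 - 7.6 * (S.radius i * S.outerRadius) := by
  have h := S.normSq_center_sub_outer hi
  rw [← normSq_neg, neg_sub] at h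
  have : S.radius o ^ 2 = S.outerRadius ^ 2 := by rw [outerRadius]; ring
  rw [centerPower, this]
  linarith

theorem centerPower_outer_neg : S.centerPower i o < 0 := by
  have h := S.centerPower_outer_le hi
  have h0 := S.radius_pos i hi
  have h1 : 3 * S.radius i ≤ S.outerRadius := S.radius_le i hi
  nlinarith

theorem le_centerPower {j : Fin 5} (hj : j ≠ o) (hji : j ≠ i) :
    S.radius i ^ 2 + 7.6 * (S.radius j * S.radius i) ≤ S.centerPower i j := by
  have h := S.normSq_center_sub_center hj hi hji
  rw [centerPower]
  linarith

theorem centerPower_pos {j : Fin 5} (hj : j ≠ o) (hji : j ≠ i) : 0 < S.centerPower i j := by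
  have h := S.le_centerPower hi hj hji
  have h0 := S.radius_pos i hi
  have h1 := S.radius_pos j hj
  have := mul_pos h1 h0
  nlinarith

theorem centerPower_ne_zero (j : Fin 5) : S.centerPower i j ≠ 0 := by
  by_cases hj : j = o
  · exact hj ▸ (S.centerPower_outer_neg hi).ne
  by_cases hji : j = i
  · rw [hji, centerPower_self]
    exact neg_ne_zero.2 (pow_ne_zero _ (S.radius_ne_zero i))
  · exact (S.centerPower_pos hi hj hji).ne'

/-- The image of a configuration under inversion in one of its inner circles. -/
noncomputable def invert : CircleConfig i where
  center j := S.center i + (S.radius i ^ 2 / S.centerPower i j : ℝ) * (S.center j - S.center i)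
  radius j := S.radius i ^ 2 * S.radius j / S.centerPower i j
  radius_outer_neg := by
    have h0 := S.radius_pos i hi
    rw [centerPower_self]
    exact div_neg_of_pos_of_neg (by positivity) (neg_lt_zero.2 (by positivity))
  radius_pos j hj := by
    have h0 := S.radius_pos i hi
    by_cases hjo : j = o
    · subst hjo
      exact div_pos_of_neg_of_neg (mul_neg_of_pos_of_neg (by positivity) S.radius_outer_neg)
        (S.centerPower_outer_neg hi)
    · have := S.radius_pos j hjo
      have := S.centerPower_pos hi hjo hj
      positivity
  radius_le j hj := by
    have h0 := S.radius_pos i hi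
    have e : -(S.radius i ^ 2 * S.radius i / S.centerPower i i) = S.radius i := by
      rw [centerPower_self]; field_simp
    rw [e]
    by_cases hjo : j = o
    · subst hjo
      have h1 := S.centerPower_outer_neg hi
      have h2 := S.centerPower_outer_le hi
      have h3 : 3 * S.radius i ≤ S.outerRadius := S.radius_le i hi
      rw [← mul_div_assoc, div_le_iff_of_neg h1]
      have h4 : S.radius j = -S.outerRadius := by rw [outerRadius]; ring
      rw [h4]
      have : S.radius i * (S.radius i + 3 * S.outerRadius) ≤
          S.radius i * (7.6 * S.outerRadius) := by gcongr; linarith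
      nlinarith
    · have h1 := S.centerPower_pos hi hjo hj
      have h2 := S.le_centerPower hi hjo hj
      have h3 := S.radius_pos j hjo
      rw [← mul_div_assoc, div_le_iff₀ h1]
      have h4 := mul_pos h3 h0
      nlinarith [sq_nonneg (S.radius i)]
  separated j k hjk := by
    rw [inversiveProduct_inverted (S.radius_ne_zero i) (S.radius_ne_zero j) (S.radius_ne_zero k)
      (P := S.centerPower i j) (T := S.centerPower i k) rfl (S.centerPower_ne_zero hi j) rfl
      (S.centerPower_ne_zero hi k)]
    exact S.separated j k hjk

omit hi in
/-- Inversion in the circle `i`. -/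
noncomputable def inv (i : Fin 5) (z : ℂ) : ℂ := circleInversion (S.center i) (S.radius i) z

theorem invert_center (j : Fin 5) : (S.invert hi).center j =
  S.center i + (S.radius i ^ 2 / S.centerPower i j : ℝ) * (S.center j - S.center i) := rfl

theorem invert_radius (j : Fin 5) : (S.invert hi).radius j =
  S.radius i ^ 2 * S.radius j / S.centerPower i j := rfl

@[simp] theorem invert_center_self : (S.invert hi).center i = S.center i := by
  simp [invert_center]

@[simp] theorem invert_outerRadius : (S.invert hi).outerRadius = S.radius i := by
  have := S.radius_ne_zero i
  rw [outerRadius, invert_radius, centerPower_self]; field_simp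

theorem power_invert_inv {z : ℂ} (hz : z ≠ S.center i) (j : Fin 5) :
    (S.invert hi).power j (S.inv i z) =
      S.radius i ^ 2 / normSq (z - S.center i) * S.power j z :=
  signedPower_circleInversion (S.radius_ne_zero i) (S.radius_ne_zero j) rfl
    (S.centerPower_ne_zero hi j) hz

theorem power_invert_center (j : Fin 5) :
    (S.invert hi).power j (S.center i) = S.radius i ^ 2 / S.radius j :=
  signedPower_inverted_center (S.radius_ne_zero i) (S.radius_ne_zero j) rfl
    (S.centerPower_ne_zero hi j)

theorem ne_center_of_mem_dom {z : ℂ} (hz : z ∈ S.dom) : z ≠ S.center i := by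
  rintro rfl
  have := (S.mem_dom_iff.1 hz).2 i hi
  simp only [sub_self, norm_zero] at this
  exact this.not_gt (S.radius_pos i hi)

theorem ne_center_of_mem_dom_invert {z : ℂ} (hz : z ∈ (S.invert hi).dom) : z ≠ S.center i := by
  rintro rfl
  have := hz o
  rw [power_invert_center] at this
  have h0 := S.radius_pos i hi
  exact this.not_gt (div_neg_of_pos_of_neg (by positivity) S.radius_outer_neg)

omit hi in
theorem inv_inv {z : ℂ} (hz : z ≠ S.center i) : S.inv i (S.inv i z) = z :=
  circleInversion_circleInversion (S.radius_ne_zero i) hz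

theorem inv_mem_dom_invert {z : ℂ} (hz : z ∈ S.dom) : S.inv i z ∈ (S.invert hi).dom := fun j => by
  have hne := S.ne_center_of_mem_dom hi hz
  rw [S.power_invert_inv hi hne]
  have h0 := S.radius_pos i hi
  have : 0 < normSq (z - S.center i) := normSq_pos.2 (sub_ne_zero.2 hne)
  have := hz j
  positivity

theorem power_inv {z : ℂ} (hz : z ≠ S.center i) (j : Fin 5) :
    S.power j (S.inv i z) =
      S.radius i ^ 2 / normSq (z - S.center i) * (S.invert hi).power j z := by
  have hne : S.inv i z ≠ S.center i := circleInversion_ne_center (S.radius_ne_zero i) hz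
  have h := S.power_invert_inv hi hne j
  rw [S.inv_inv hz, inv, normSq_circleInversion_sub hz] at h
  have h0 := S.radius_ne_zero i
  have : normSq (z - S.center i) ≠ 0 := (normSq_pos.2 (sub_ne_zero.2 hz)).ne'
  rw [h, inv]
  field_simp

theorem inv_mem_dom {z : ℂ} (hz : z ∈ (S.invert hi).dom) : S.inv i z ∈ S.dom := fun j => by
  have hne := S.ne_center_of_mem_dom_invert hi hz
  rw [S.power_inv hi hne]
  have h0 := S.radius_pos i hi
  have : 0 < normSq (z - S.center i) := normSq_pos.2 (sub_ne_zero.2 hne)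
  have := hz j
  positivity

omit hi

theorem tendsto_boundaryEnd_of_power_le {o' j : Fin 5} {S' : CircleConfig o'} {F : ℂ → ℂ} {K : ℝ}
    {T : CircleConfig o}
    (hF : MapsTo F T.dom S'.dom) (h : ∀ z ∈ T.dom, S'.power j (F z) ≤ K * T.power j z) :
    Tendsto F (T.boundaryEnd j) (S'.boundaryEnd j) := by
  refine tendsto_inf.2 ⟨tendsto_comap_iff.2 ?_, ?_⟩
  · have h1 : Tendsto (fun z => K * T.power j z) (T.boundaryEnd j) (𝓝 0) := by
      have : Tendsto (T.power j) (T.boundaryEnd j) (𝓝 0) := tendsto_comap.mono_left inf_le_left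
      simpa using this.const_mul K
    have hm : T.dom ∈ T.boundaryEnd j := mem_inf_of_right (mem_principal_self _)
    refine tendsto_of_tendsto_of_tendsto_of_le_of_le' tendsto_const_nhds h1 ?_ ?_
    · filter_upwards [hm] with z hz using (hF hz j).le
    · filter_upwards [hm] with z hz using h z hz
  · exact (hF.tendsto).mono_left inf_le_right

include hi

theorem tendsto_inv_boundaryEnd (j : Fin 5) :
    Tendsto (S.inv i) (S.boundaryEnd j) ((S.invert hi).boundaryEnd j) := by
  refine tendsto_boundaryEnd_of_power_le (K := 1) (fun z hz => S.inv_mem_dom_invert hi hz) ?_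
  intro z hz
  have hne := S.ne_center_of_mem_dom hi hz
  rw [S.power_invert_inv hi hne]
  have h0 := S.radius_pos i hi
  have h1 := (S.mem_dom_iff.1 hz).2 i hi
  refine mul_le_mul_of_nonneg_right ?_ (hz j).le
  rw [normSq_eq_norm_sq]
  exact div_le_one_of_le₀ (by gcongr) (by positivity)

theorem tendsto_inv_boundaryEnd_invert (j : Fin 5) :
    Tendsto (S.inv i) ((S.invert hi).boundaryEnd j) (S.boundaryEnd j) := by
  refine tendsto_boundaryEnd_of_power_le (K := (2 * S.outerRadius) ^ 2 / S.radius i ^ 2)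
    (fun z hz => S.inv_mem_dom hi hz) ?_
  intro z hz
  have hne := S.ne_center_of_mem_dom_invert hi hz
  rw [S.power_inv hi hne]
  have h0 := S.radius_pos i hi
  refine mul_le_mul_of_nonneg_right ?_ (hz j).le
  have h1 := (S.mem_dom_iff.1 (S.inv_mem_dom hi hz)).1
  have h2 := S.norm_center_sub_add_radius_lt hi
  have h3 : ‖S.inv i z - S.center i‖ ≤ 2 * S.outerRadius := by
    calc _ = ‖(S.inv i z - S.center o) - (S.center i - S.center o)‖ := by ring_nf
      _ ≤ _ := (norm_sub_le _ _).trans (by linarith)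
  have h4 := normSq_circleInversion_sub (r := S.radius i) hne
  have : 0 < normSq (z - S.center i) := normSq_pos.2 (sub_ne_zero.2 hne)
  calc S.radius i ^ 2 / normSq (z - S.center i)
      = normSq (S.inv i z - S.center i) / S.radius i ^ 2 := by
        rw [inv, h4]; field_simp
    _ ≤ _ := by rw [normSq_eq_norm_sq]; gcongr

end CircleConfig

theorem differentiableAt_circleInversion_comp {F : ℂ → ℂ} {c c' z : ℂ} {r r' : ℝ} (hz : z ≠ c)
    (hF : DifferentiableAt ℂ F (circleInversion c r z)) (hne : F (circleInversion c r z) ≠ c') :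
    DifferentiableAt ℂ (circleInversion c' r' ∘ F ∘ circleInversion c r) z := by
  set conj := starRingEnd ℂ
  have h0 : circleInversion c' r' ∘ F ∘ circleInversion c r = fun w =>
      c' + r' ^ 2 / ((conj ∘ F ∘ conj) (conj c + r ^ 2 / (w - c)) - conj c') := by
    funext w
    have : circleInversion c r w = conj (conj c + r ^ 2 / (w - c)) := by
      rw [circleInversion_eq_div]; simp [conj]
    simp only [Function.comp_apply]
    rw [circleInversion_eq_div c', ← this, ← map_sub]
  have h1 : conj (conj c + r ^ 2 / (z - c)) = circleInversion c r z := by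
    rw [circleInversion_eq_div]; simp [conj]
  have hzc : z - c ≠ 0 := sub_ne_zero.2 hz
  rw [h0]
  have h2 : DifferentiableAt ℂ (conj ∘ F ∘ conj) (conj c + r ^ 2 / (z - c)) := by
    have h3 : DifferentiableAt ℂ F (conj (conj c + r ^ 2 / (z - c))) := h1 ▸ hF
    have := h3.conj_conj
    rwa [conj_conj] at this
  have h4 : DifferentiableAt ℂ (fun w => conj c + r ^ 2 / (w - c)) z :=
    (((differentiableAt_const _).div (differentiableAt_id.sub_const c)) hzc).const_add _
  refine ((differentiableAt_const _).div
    ((DifferentiableAt.comp (g := conj ∘ F ∘ conj) z h2 h4).sub_const _) ?_).const_add _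
  simp only [Function.comp_apply]
  rw [h1, ← map_sub]
  exact (map_ne_zero _).2 (sub_ne_zero.2 hne)

theorem circleInversion_circleMap {c : ℂ} {r s : ℝ} (hs : s ≠ 0) (θ : ℝ) :
    circleInversion c r (circleMap c s θ) = circleMap c (r ^ 2 / s) θ := by
  have h : normSq (circleMap c s θ - c) = s ^ 2 := by
    rw [normSq_eq_norm_sq, circleMap_sub_center]; simp
  rw [circleInversion, h, circleMap_sub_center]
  simp only [circleMap, zero_add, ← mul_assoc]
  congr 2
  have : (s : ℂ) ≠ 0 := by exact_mod_cast hs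
  push_cast; field_simp

theorem norm_circleInversion_sub_le {c w : ℂ} {r : ℝ} (hr : 0 < r) (hw : r ≤ ‖w - c‖) :
    ‖circleInversion c r w - w‖ ≤ signedPower c r w := by
  have h0 : 0 < ‖w - c‖ := hr.trans_le hw
  have h1 : circleInversion c r w - w = ((r ^ 2 - ‖w - c‖ ^ 2) / ‖w - c‖ ^ 2 : ℝ) * (w - c) := by
    have : (‖w - c‖ : ℂ) ≠ 0 := by exact_mod_cast h0.ne'
    rw [circleInversion, normSq_eq_norm_sq]
    push_cast
    field_simp
    ring
  have hsq : r ^ 2 ≤ ‖w - c‖ ^ 2 := by gcongr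
  rw [h1, norm_mul, norm_real, Real.norm_eq_abs, abs_div, abs_of_nonpos (by linarith),
    abs_of_pos (by positivity), signedPower, normSq_eq_norm_sq]
  have : -(r ^ 2 - ‖w - c‖ ^ 2) / ‖w - c‖ ^ 2 * ‖w - c‖ = (‖w - c‖ ^ 2 - r ^ 2) / ‖w - c‖ := by
    field_simp; ring
  rw [this]
  exact div_le_div_of_nonneg_left (by linarith) hr hw

namespace CircleConfig

variable {o : Fin 5}

/-- A holomorphic map between two circle domains that matches up their boundary circles. -/
structure IsAdmissible (S S' : CircleConfig o) (F : ℂ → ℂ) : Prop where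
  mapsTo : MapsTo F S.dom S'.dom
  differentiableOn : DifferentiableOn ℂ F S.dom
  tendsto_boundaryEnd : ∀ j, Tendsto F (S.boundaryEnd j) (S'.boundaryEnd j)

theorem IsAdmissible.invert {S S' : CircleConfig o} {F : ℂ → ℂ} (h : IsAdmissible S S' F)
    {i : Fin 5} (hi : i ≠ o) :
    IsAdmissible (S.invert hi) (S'.invert hi) (S'.inv i ∘ F ∘ S.inv i) where
  mapsTo z hz := S'.inv_mem_dom_invert hi (h.mapsTo (S.inv_mem_dom hi hz))
  differentiableOn z hz := by
    have h1 := S.inv_mem_dom hi hz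
    exact (differentiableAt_circleInversion_comp (S.ne_center_of_mem_dom_invert hi hz)
      (h.differentiableOn.differentiableAt (S.isOpen_dom.mem_nhds h1))
      (S'.ne_center_of_mem_dom hi (h.mapsTo h1))).differentiableWithinAt
  tendsto_boundaryEnd j := (S'.tendsto_inv_boundaryEnd hi j).comp
    ((h.tendsto_boundaryEnd j).comp (S.tendsto_inv_boundaryEnd_invert hi j))

variable (S : CircleConfig o)

theorem eventually_mul_lt {a b : ℝ} (h : a < b) : ∀ᶠ l in 𝓝[>] (1 : ℝ), l * a < b := by
  have : Tendsto (fun l : ℝ => l * a) (𝓝[>] 1) (𝓝 (1 * a)) :=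
    ((continuous_id.mul continuous_const).tendsto 1).mono_left nhdsWithin_le_nhds
  rw [one_mul] at this
  exact this.eventually (gt_mem_nhds h)

/-- The radius `t` is that of a circle around the inner discs in the outer one. -/
def Encloses (t : ℝ) : Prop :=
  t < S.outerRadius ∧ ∀ j, j ≠ o → ‖S.center j - S.center o‖ + S.radius j < t

/-- Dilating the inner circles by the factor `l` keeps them disjoint and inside the circle of
radius `t`. -/
structure IsDilation (t l : ℝ) : Prop where
  one_lt : 1 < l
  inner : ∀ j, j ≠ o → closedBall (S.center j) (l * S.radius j) ⊆ ball (S.center o) t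
  disj : ∀ j, j ≠ o → ∀ k, k ≠ o → j ≠ k → Disjoint (closedBall (S.center j) (l * S.radius j))
    (closedBall (S.center k) (l * S.radius k))

variable {S} {t : ℝ}

theorem Encloses.pos (ht : S.Encloses t) : 0 < t := by
  obtain ⟨j, hj⟩ := exists_ne o
  have := ht.2 j hj
  have := S.radius_pos j hj
  have := norm_nonneg (S.center j - S.center o)
  linarith

theorem Encloses.eventually_isDilation (ht : S.Encloses t) :
    ∀ᶠ l in 𝓝[>] (1 : ℝ), S.IsDilation t l := by
  have h1 : ∀ᶠ l in 𝓝[>] (1 : ℝ), ∀ j, j ≠ o →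
      l * S.radius j < t - ‖S.center j - S.center o‖ := by
    refine eventually_all.2 fun j => ?_
    by_cases hj : j = o
    · exact Eventually.of_forall fun l h => absurd hj h
    · filter_upwards [eventually_mul_lt (by linarith [ht.2 j hj] :
        S.radius j < t - ‖S.center j - S.center o‖)] with l hl _ using hl
  have h2 : ∀ᶠ l in 𝓝[>] (1 : ℝ), ∀ j k, j ≠ o → k ≠ o → j ≠ k →
      l * (S.radius j + S.radius k) < ‖S.center j - S.center k‖ := by
    refine eventually_all.2 fun j => eventually_all.2 fun k => ?_
    by_cases h : j ≠ o ∧ k ≠ o ∧ j ≠ k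
    · filter_upwards [eventually_mul_lt (S.radius_add_radius_lt h.1 h.2.1 h.2.2)]
        with l hl _ _ _ using hl
    · exact Eventually.of_forall fun l h1 h2 h3 => absurd ⟨h1, h2, h3⟩ h
  filter_upwards [h1, h2, self_mem_nhdsWithin] with l hl1 hl2 hl
  refine ⟨hl, fun j hj => closedBall_subset_ball' ?_, fun j hj k hk hjk =>
    closedBall_disjoint_closedBall ?_⟩
  · rw [dist_eq_norm]; linarith [hl1 j hj]
  · rw [dist_eq_norm]; linarith [hl2 j k hj hk hjk]

theorem IsDilation.diff_subset_dom {l : ℝ} (h : S.IsDilation t l) (ht : S.Encloses t) :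
    closedBall (S.center o) t \ ⋃ j ∈ Finset.univ.erase o, ball (S.center j) (l * S.radius j) ⊆
      S.dom := by
  intro z hz
  rw [S.mem_dom_iff]
  refine ⟨?_, fun j hj => ?_⟩
  · have := hz.1
    rw [mem_closedBall, dist_eq_norm] at this
    exact this.trans_lt ht.1
  · have h1 := hz.2
    simp only [Finset.mem_erase, Finset.mem_univ, and_true, mem_iUnion, not_exists, mem_ball,
      not_lt, dist_eq_norm] at h1
    have := h1 j hj
    have := S.radius_pos j hj
    nlinarith [h.one_lt]

theorem IsDilation.sphere_subset {l : ℝ} (h : S.IsDilation t l) {j : Fin 5} (hj : j ≠ o) :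
    sphere (S.center j) (l * S.radius j) ⊆ closedBall (S.center o) t \
      ⋃ j ∈ Finset.univ.erase o, ball (S.center j) (l * S.radius j) := by
  intro z hz
  refine ⟨ball_subset_closedBall (h.inner j hj (sphere_subset_closedBall hz)), ?_⟩
  simp only [Finset.mem_erase, Finset.mem_univ, and_true, mem_iUnion, not_exists]
  intro k hk hzk
  by_cases hjk : j = k
  · subst hjk
    exact (mem_ball.1 hzk).ne (mem_sphere.1 hz)
  · exact (h.disj j hj k hk hjk).le_bot ⟨sphere_subset_closedBall hz, ball_subset_closedBall hzk⟩

theorem IsDilation.circleIntegral_eq_sum {l : ℝ} (h : S.IsDilation t l) (ht : S.Encloses t)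
    {f : ℂ → ℂ} (hf : DifferentiableOn ℂ f S.dom) :
    (∮ z in C(S.center o, t), f z) =
      ∑ j ∈ Finset.univ.erase o, ∮ z in C(S.center j, l * S.radius j), f z := by
  have hl := h.one_lt
  refine circleIntegral_eq_sum_of_differentiableOn ht.pos.le S.center (fun j => l * S.radius j)
    (Finset.univ.erase o) ?_ ?_ ?_ S.isOpen_dom hf (h.diff_subset_dom ht)
  · intro j hj
    have := S.radius_pos j (Finset.ne_of_mem_erase hj)
    positivity
  · exact fun j hj => h.inner j (Finset.ne_of_mem_erase hj)
  · exact fun j hj k hk => h.disj j (Finset.ne_of_mem_erase hj) k (Finset.ne_of_mem_erase hk)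

theorem exists_encloses_gt {s : ℝ} (hs : s < S.outerRadius) : ∃ t, S.Encloses t ∧ s < t := by
  have h : ∀ᶠ t in 𝓝[<] S.outerRadius, ∀ j, j ≠ o → ‖S.center j - S.center o‖ + S.radius j < t := by
    refine eventually_all.2 fun j => ?_
    by_cases hj : j = o
    · exact Eventually.of_forall fun l h => absurd hj h
    · filter_upwards [nhdsWithin_le_nhds (lt_mem_nhds (S.norm_center_sub_add_radius_lt hj))]
        with t ht _ using ht
  have hlt : ∀ᶠ t in 𝓝[<] S.outerRadius, s < t := nhdsWithin_le_nhds (lt_mem_nhds hs)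
  obtain ⟨t, h1, h2, h3⟩ := (h.and (hlt.and self_mem_nhdsWithin)).exists
  exact ⟨t, ⟨h3, h1⟩, h2⟩

/-- The limit of the difference of the integrals over two circles that are close to the circle `j`
and are interchanged by the inversion in it. -/
theorem IsAdmissible.tendsto_circleIntegral_sub {S' : CircleConfig o} {F : ℂ → ℂ}
    (h : IsAdmissible S S' F) {j : Fin 5} (hj : j ≠ o) {g : ℂ → ℂ}
    {U : Set ℂ} (hU : IsOpen U) (hjU : closedBall (S.center j) (S.radius j) ⊆ U)
    (hg : ContinuousOn g U) :
    Tendsto (fun l : ℝ => (∮ z in C(S.center j, l * S.radius j), F z * g z) -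
      ∮ z in C(S.center j, S.radius j / l), (S'.inv j ∘ F ∘ S.inv j) z * g z)
      (𝓝[>] 1) (𝓝 0) := by
  set G := S'.inv j ∘ F ∘ S.inv j with hG
  have hadm : IsAdmissible (S.invert hj) (S'.invert hj) G := h.invert hj
  set c := S.center j
  set ρ := S.radius j
  have hρ : 0 < ρ := S.radius_pos j hj
  have hρ' := S'.radius_pos j hj
  obtain ⟨t, ht, -⟩ := S.exists_encloses_gt S.outerRadius_pos
  obtain ⟨l₀, hl₀, hsub⟩ : ∃ l₀ > 1, closedBall c (l₀ * ρ) ⊆ U := by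
    obtain ⟨δ, hδ, hδU⟩ := (isCompact_closedBall c ρ).exists_cthickening_subset_open hU hjU
    rw [cthickening_closedBall hδ.le hρ.le] at hδU
    refine ⟨1 + δ / ρ, by simp only [gt_iff_lt, lt_add_iff_pos_right]; positivity, ?_⟩
    rwa [add_mul, one_mul, div_mul_cancel₀ _ hρ.ne', add_comm]
  obtain ⟨M, hM⟩ := (isCompact_closedBall c (l₀ * ρ)).exists_bound_of_continuousOn (hg.mono hsub)
  have hev : ∀ᶠ l in 𝓝[>] (1 : ℝ), S.IsDilation t l ∧ l < l₀ ∧ 1 < l := by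
    filter_upwards [ht.eventually_isDilation, nhdsWithin_le_nhds (gt_mem_nhds hl₀)] with l h1 h2
      using ⟨h1, h2, h1.one_lt⟩
  have hz : ∀ l, S.IsDilation t l → ∀ θ, circleMap c (l * ρ) θ ∈ S.dom := fun l hl θ =>
    hl.diff_subset_dom ht (hl.sphere_subset hj (circleMap_mem_sphere c
      (mul_pos (one_pos.trans hl.one_lt) hρ).le θ))
  have hinv : ∀ l : ℝ, 1 < l → ∀ θ, S.inv j (circleMap c (ρ / l) θ) = circleMap c (l * ρ) θ := by
    intro l hl θ
    have : 0 < l := one_pos.trans hl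
    rw [inv, circleInversion_circleMap (by positivity)]
    congr 1
    change ρ ^ 2 / _ = _
    field_simp
  have hinv' : ∀ l : ℝ, 1 < l → ∀ θ, S.inv j (circleMap c (l * ρ) θ) = circleMap c (ρ / l) θ := by
    intro l hl θ
    have : 0 < l := one_pos.trans hl
    rw [inv, circleInversion_circleMap (by positivity)]
    congr 1
    change ρ ^ 2 / _ = _
    field_simp
  have hz' : ∀ l, S.IsDilation t l → ∀ θ, circleMap c (ρ / l) θ ∈ (S.invert hj).dom := fun l hl θ =>
    hinv' l hl.one_lt θ ▸ S.inv_mem_dom_invert hj (hz l hl θ)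
  have hGF : ∀ l : ℝ, 1 < l → ∀ θ, G (circleMap c (ρ / l) θ) = S'.inv j (F (circleMap c (l * ρ) θ)) :=
    fun l hl θ => by simp only [hG, Function.comp_apply, hinv l hl]
  obtain ⟨KF, hKF⟩ : ∃ K, ∀ z ∈ S.dom, ‖F z‖ ≤ K :=
    ⟨S'.outerRadius + ‖S'.center o‖, fun z hz => by
      have h1 := (S'.mem_dom_iff.1 (h.mapsTo hz)).1
      linarith [norm_le_norm_sub_add (F z) (S'.center o)]⟩
  obtain ⟨KG, hKG⟩ : ∃ K, ∀ z ∈ (S.invert hj).dom, ‖G z‖ ≤ K :=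
    ⟨(S'.invert hj).outerRadius + ‖(S'.invert hj).center j‖, fun z hz => by
      have h1 := ((S'.invert hj).mem_dom_iff.1 (hadm.mapsTo hz)).1
      linarith [norm_le_norm_sub_add (G z) ((S'.invert hj).center j)]⟩
  have hmem : ∀ l, l < l₀ → 1 < l → ∀ θ, circleMap c (l * ρ) θ ∈ closedBall c (l₀ * ρ) := by
    intro l h1 h2 θ
    refine closedBall_subset_closedBall (by gcongr) (circleMap_mem_closedBall c ?_ θ)
    have : 0 < l := one_pos.trans h2
    positivity
  have hmem' : ∀ l : ℝ, 1 < l → ∀ θ, circleMap c (ρ / l) θ ∈ closedBall c (l₀ * ρ) := by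
    intro l h2 θ
    have : 0 < l := one_pos.trans h2
    refine closedBall_subset_closedBall ?_ (circleMap_mem_closedBall c (by positivity) θ)
    rw [div_le_iff₀ this]
    nlinarith [mul_pos hρ (sub_pos.2 hl₀), mul_pos hρ (sub_pos.2 h2), one_lt_mul hl₀.le h2]
  set Φ : ℝ → ℝ → ℂ := fun l θ =>
    deriv (circleMap c (l * ρ)) θ • (F (circleMap c (l * ρ) θ) * g (circleMap c (l * ρ) θ)) with hΦ
  set Ψ : ℝ → ℝ → ℂ := fun l θ =>
    deriv (circleMap c (ρ / l)) θ • (G (circleMap c (ρ / l) θ) * g (circleMap c (ρ / l) θ)) with hΨ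
  have hΦc : ∀ l, S.IsDilation t l → l < l₀ → Continuous (Φ l) := by
    intro l hl hl'
    simp only [hΦ, deriv_circleMap, smul_eq_mul]
    exact ((continuous_circleMap 0 _).mul continuous_const).mul
      ((h.differentiableOn.continuousOn.comp_continuous (continuous_circleMap c _) (hz l hl)).mul
      (hg.comp_continuous (continuous_circleMap c _) fun θ => hsub (hmem l hl' hl.one_lt θ)))
  have hΨc : ∀ l, S.IsDilation t l → Continuous (Ψ l) := by
    intro l hl
    simp only [hΨ, deriv_circleMap, smul_eq_mul]
    exact ((continuous_circleMap 0 _).mul continuous_const).mul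
      ((hadm.differentiableOn.continuousOn.comp_continuous (continuous_circleMap c _)
        (hz' l hl)).mul
      (hg.comp_continuous (continuous_circleMap c _) fun θ => hsub (hmem' l hl.one_lt θ)))
  have key : Tendsto (fun l : ℝ => ∫ θ in (0 : ℝ)..2 * Real.pi, (Φ l θ - Ψ l θ)) (𝓝[>] 1)
      (𝓝 (∫ θ in (0 : ℝ)..2 * Real.pi, (0 : ℂ))) := by
    refine intervalIntegral.tendsto_integral_filter_of_dominated_convergence
      (fun _ => l₀ * ρ * (KF * M) + ρ * (KG * M)) ?_ ?_ intervalIntegrable_const ?_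
    · filter_upwards [hev] with l hl
      exact ((hΦc l hl.1 hl.2.1).sub (hΨc l hl.1)).aestronglyMeasurable
    · filter_upwards [hev] with l hl
      refine Eventually.of_forall fun θ _ => (norm_sub_le _ _).trans (add_le_add ?_ ?_)
      · have hl0 : 0 < l := one_pos.trans hl.2.2
        simp only [hΦ, deriv_circleMap, smul_eq_mul, norm_mul, norm_circleMap_zero, norm_I, mul_one]
        rw [abs_of_pos (by positivity)]
        have h1 := hKF _ (hz l hl.1 θ)
        have h2 := hM _ (hmem l hl.2.1 hl.2.2 θ)
        have := (norm_nonneg _).trans h1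
        gcongr
        exact hl.2.1.le
      · have hl0 : 0 < l := one_pos.trans hl.2.2
        simp only [hΨ, deriv_circleMap, smul_eq_mul, norm_mul, norm_circleMap_zero, norm_I, mul_one]
        rw [abs_of_pos (by positivity)]
        have h1 := hKG _ (hz' l hl.1 θ)
        have h2 := hM _ (hmem' l hl.2.2 θ)
        have := (norm_nonneg _).trans h1
        gcongr
        exact div_le_self hρ.le hl.2.2.le
    · refine Eventually.of_forall fun θ _ => ?_
      set X : ℝ → ℂ := fun l => deriv (circleMap c (l * ρ)) θ * g (circleMap c (l * ρ) θ) with hX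
      set Y : ℝ → ℂ := fun l => deriv (circleMap c (ρ / l)) θ * g (circleMap c (ρ / l) θ) with hY
      have e : ∀ l, 1 < l → (F (circleMap c (l * ρ) θ) - G (circleMap c (ρ / l) θ)) * X l +
          G (circleMap c (ρ / l) θ) * (X l - Y l) = Φ l θ - Ψ l θ := by
        intro l _
        simp only [hX, hY, hΦ, hΨ, smul_eq_mul]; ring
      refine Tendsto.congr' (f₁ := fun l => (F (circleMap c (l * ρ) θ) - G (circleMap c (ρ / l) θ)) * X l +
          G (circleMap c (ρ / l) θ) * (X l - Y l))
        (by filter_upwards [self_mem_nhdsWithin] with l hl using e l hl) ?_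
      have hgc : ContinuousAt g (circleMap c ρ θ) := by
        refine hg.continuousAt (hU.mem_nhds (hsub ?_))
        exact closedBall_subset_closedBall (by nlinarith) (circleMap_mem_closedBall c hρ.le θ)
      have hlim : ∀ u : ℝ → ℝ, Tendsto u (𝓝[>] 1) (𝓝 ρ) →
          Tendsto (fun l => deriv (circleMap c (u l)) θ * g (circleMap c (u l) θ)) (𝓝[>] 1)
            (𝓝 (deriv (circleMap c ρ) θ * g (circleMap c ρ θ))) := by
        intro u hu
        have hc : ∀ c : ℂ, Continuous fun s : ℝ => circleMap c s θ := fun c => by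
          unfold circleMap; fun_prop
        simp only [deriv_circleMap]
        exact ((((hc 0).tendsto ρ).comp hu).mul_const I).mul
          (hgc.tendsto.comp (((hc c).tendsto ρ).comp hu))
      have hu1 : Tendsto (fun l : ℝ => l * ρ) (𝓝[>] 1) (𝓝 ρ) := by
        have : Tendsto (fun l : ℝ => l * ρ) (𝓝 1) (𝓝 (1 * ρ)) :=
          (continuous_id.mul continuous_const).tendsto 1
        rw [one_mul] at this
        exact this.mono_left nhdsWithin_le_nhds
      have hu2 : Tendsto (fun l : ℝ => ρ / l) (𝓝[>] 1) (𝓝 ρ) := by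
        have : Tendsto (fun l : ℝ => ρ / l) (𝓝 1) (𝓝 (ρ / 1)) :=
          tendsto_const_nhds.div tendsto_id one_ne_zero
        rw [div_one] at this
        exact this.mono_left nhdsWithin_le_nhds
      have hXl := hlim _ hu1
      have hYl := hlim _ hu2
      have hend : Tendsto (fun l : ℝ => circleMap c (l * ρ) θ) (𝓝[>] 1) (S.boundaryEnd j) := by
        refine tendsto_inf.2 ⟨tendsto_comap_iff.2 ?_, tendsto_principal.2 ?_⟩
        · have : S.power j (circleMap c ρ θ) = 0 := by
            rw [power, signedPower, normSq_eq_norm_sq, circleMap_sub_center]; simp [ρ]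
          rw [← this]
          have hc : Continuous fun s : ℝ => circleMap c s θ := by unfold circleMap; fun_prop
          exact ((S.continuous_power j).tendsto _).comp ((hc.tendsto ρ).comp hu1)
        · filter_upwards [hev] with l hl using hz l hl.1 θ
      have hpow : Tendsto (fun l : ℝ => S'.power j (F (circleMap c (l * ρ) θ))) (𝓝[>] 1) (𝓝 0) :=
        (tendsto_comap.mono_left inf_le_left).comp ((h.tendsto_boundaryEnd j).comp hend)
      have hFG : Tendsto (fun l : ℝ => F (circleMap c (l * ρ) θ) - G (circleMap c (ρ / l) θ))
          (𝓝[>] 1) (𝓝 0) := by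
        refine squeeze_zero_norm' ?_ hpow
        filter_upwards [hev] with l hl
        rw [hGF l hl.2.2, norm_sub_rev]
        exact norm_circleInversion_sub_le hρ'
          ((S'.mem_dom_iff.1 (h.mapsTo (hz l hl.1 θ))).2 j hj).le
      have hGb : IsBoundedUnder (· ≤ ·) (𝓝[>] (1 : ℝ))
          ((fun x => ‖x‖) ∘ fun l : ℝ => G (circleMap c (ρ / l) θ)) := by
        refine isBoundedUnder_of_eventually_le (a := KG) ?_
        filter_upwards [hev] with l hl using hKG _ (hz' l hl.1 θ)
      have hXY : Tendsto (fun l => X l - Y l) (𝓝[>] 1) (𝓝 0) := by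
        have := hXl.sub hYl
        rwa [sub_self] at this
      have h1 := hFG.mul hXl
      have h2 := isBoundedUnder_le_mul_tendsto_zero hGb hXY
      have h3 := h1.add h2
      rwa [zero_mul, add_zero] at h3
  rw [intervalIntegral.integral_zero] at key
  refine key.congr' ?_
  filter_upwards [hev] with l hl
  rw [intervalIntegral.integral_sub ((hΦc l hl.1 hl.2.1).intervalIntegrable _ _)
    ((hΨc l hl.1).intervalIntegrable _ _)]
  rfl

end CircleConfig

namespace CircleConfig

theorem Encloses.sphere_subset_dom {o : Fin 5} {S : CircleConfig o} {t : ℝ} (ht : S.Encloses t) :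
    sphere (S.center o) t ⊆ S.dom := by
  intro z hz
  rw [mem_sphere, dist_eq_norm] at hz
  refine S.mem_dom_iff.2 ⟨hz ▸ ht.1, fun j hj => ?_⟩
  have h1 := ht.2 j hj
  have h2 := norm_add_le (z - S.center j) (S.center j - S.center o)
  rw [sub_add_sub_cancel, hz] at h2
  linarith

theorem closedBall_subset_ball_outer {o : Fin 5} (S : CircleConfig o) {j : Fin 5} (hj : j ≠ o) :
    closedBall (S.center j) (S.radius j) ⊆ ball (S.center o) S.outerRadius := by
  refine closedBall_subset_ball' ?_
  rw [dist_eq_norm]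
  linarith [S.norm_center_sub_add_radius_lt hj]

theorem eventually_encloses_invert {o : Fin 5} (S : CircleConfig o) {j : Fin 5} (hj : j ≠ o) :
    ∀ᶠ l in 𝓝[>] (1 : ℝ), (S.invert hj).Encloses (S.radius j / l) := by
  have hρ := S.radius_pos j hj
  have h : ∀ᶠ l in 𝓝[>] (1 : ℝ), ∀ k, k ≠ j →
      l * (‖(S.invert hj).center k - (S.invert hj).center j‖ + (S.invert hj).radius k) <
        S.radius j := by
    refine eventually_all.2 fun k => ?_
    by_cases hk : k = j
    · exact Eventually.of_forall fun l h => absurd hk h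
    · have := (S.invert hj).norm_center_sub_add_radius_lt hk
      rw [invert_outerRadius] at this
      filter_upwards [eventually_mul_lt this] with l hl _ using hl
  filter_upwards [h, self_mem_nhdsWithin] with l hl hl1
  have hl0 : 0 < l := one_pos.trans hl1
  refine ⟨?_, fun k hk => ?_⟩
  · rw [invert_outerRadius]
    exact div_lt_self hρ hl1
  · rw [lt_div_iff₀ hl0, mul_comm]
    exact hl k hk

theorem IsAdmissible.norm_circleIntegral_le (n : ℕ) {o : Fin 5} {S S' : CircleConfig o}
    {F : ℂ → ℂ} (h : IsAdmissible S S' F) {g : ℂ → ℂ} {M : ℝ}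
    (hg : DifferentiableOn ℂ g (ball (S.center o) S.outerRadius))
    (hM : ∀ z ∈ ball (S.center o) S.outerRadius, ‖g z‖ ≤ M) {t : ℝ} (ht : S.Encloses t) :
    ‖∮ z in C(S.center o, t), F z * g z‖ ≤
      2 * Real.pi * M * S.outerRadius * S'.outerRadius / 2 ^ n := by
  have hM0 : 0 ≤ M := (norm_nonneg _).trans (hM _ (mem_ball_self S.outerRadius_pos))
  have hR := S.outerRadius_pos
  have hR' := S'.outerRadius_pos
  have hcl : closedBall (S.center o) t ⊆ ball (S.center o) S.outerRadius :=
    closedBall_subset_ball ht.1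
  induction n generalizing o S S' F t with
  | zero =>
    have hFc : ContinuousOn F (sphere (S.center o) t) :=
      h.differentiableOn.continuousOn.mono ht.sphere_subset_dom
    have hgc : ContinuousOn g (sphere (S.center o) t) :=
      hg.continuousOn.mono (sphere_subset_closedBall.trans hcl)
    have hsub : (∮ z in C(S.center o, t), F z * g z) =
        ∮ z in C(S.center o, t), (F z - S'.center o) * g z := by
      have h0 := circleIntegral_eq_zero_of_differentiableOn ht.pos.le isOpen_ball hcl hg
      have h1 : (fun z => (F z - S'.center o) * g z) =
          fun z => F z * g z - S'.center o * g z := by funext z; ring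
      rw [h1, circleIntegral.integral_sub (f := fun z => F z * g z)
        (g := fun z => S'.center o * g z) ((hFc.mul hgc).circleIntegrable ht.pos.le)
        ((continuousOn_const.mul hgc).circleIntegrable ht.pos.le),
        circleIntegral.integral_const_mul, h0, mul_zero, sub_zero]
    rw [hsub]
    refine (circleIntegral.norm_integral_le_of_norm_le_const ht.pos.le
      (C := S'.outerRadius * M) fun z hz => ?_).trans ?_
    · rw [norm_mul]
      have h1 := (S'.mem_dom_iff.1 (h.mapsTo (ht.sphere_subset_dom hz))).1
      have h2 := hM z (hcl (sphere_subset_closedBall hz))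
      gcongr
    · have := ht.1
      rw [pow_zero, div_one]
      calc 2 * Real.pi * t * (S'.outerRadius * M)
          ≤ 2 * Real.pi * S.outerRadius * (S'.outerRadius * M) := by gcongr
        _ = _ := by ring
  | succ n ih =>
    have hchild : ∀ j ∈ Finset.univ.erase o, ∀ᶠ l in 𝓝[>] (1 : ℝ),
        ‖∮ z in C(S.center j, S.radius j / l), (S'.inv j ∘ F ∘ S.inv j) z * g z‖ ≤
          2 * Real.pi * M * S.radius j * S'.radius j / 2 ^ n := by
      intro j hj
      have hj := Finset.ne_of_mem_erase hj
      have hball : ball (S.center j) (S.radius j) ⊆ ball (S.center o) S.outerRadius :=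
        ball_subset_closedBall.trans (S.closedBall_subset_ball_outer hj)
      filter_upwards [S.eventually_encloses_invert hj] with l hl
      have := ih (h.invert hj) (by simpa using hg.mono hball)
        (by simpa using fun z hz => hM z (hball hz)) hl (outerRadius_pos _) (outerRadius_pos _)
        (closedBall_subset_ball hl.1)
      simpa using this
    have hlim : Tendsto (fun l : ℝ => ∑ j ∈ Finset.univ.erase o,
        ((∮ z in C(S.center j, l * S.radius j), F z * g z) -
          ∮ z in C(S.center j, S.radius j / l), (S'.inv j ∘ F ∘ S.inv j) z * g z))
        (𝓝[>] 1) (𝓝 (∑ j ∈ Finset.univ.erase o, 0)) :=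
      tendsto_finsetSum _ fun j hj =>
        h.tendsto_circleIntegral_sub (Finset.ne_of_mem_erase hj) isOpen_ball
          (S.closedBall_subset_ball_outer (Finset.ne_of_mem_erase hj)) hg.continuousOn
    rw [Finset.sum_const_zero] at hlim
    have hbound : ∑ j ∈ Finset.univ.erase o,
        2 * Real.pi * M * S.radius j * S'.radius j / 2 ^ n ≤
          2 * Real.pi * M * S.outerRadius * S'.outerRadius / 2 ^ (n + 1) := by
      have h1 : ∀ j ∈ Finset.univ.erase o, 2 * Real.pi * M * S.radius j * S'.radius j / 2 ^ n ≤
          2 * Real.pi * M * (S.outerRadius / 3) * (S'.outerRadius / 3) / 2 ^ n := by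
        intro j hj
        have hj := Finset.ne_of_mem_erase hj
        have h2 : 3 * S.radius j ≤ S.outerRadius := S.radius_le j hj
        have h3 : 3 * S'.radius j ≤ S'.outerRadius := S'.radius_le j hj
        have h4 := S.radius_pos j hj
        have h5 := S'.radius_pos j hj
        gcongr <;> linarith
      refine (Finset.sum_le_sum h1).trans ?_
      rw [Finset.sum_const, Finset.card_erase_of_mem (Finset.mem_univ _), Finset.card_univ,
        Fintype.card_fin, pow_succ]
      have : 0 ≤ 2 * Real.pi * M * S.outerRadius * S'.outerRadius / 2 ^ n := by positivity
      calc _ = 4 / 9 * (2 * Real.pi * M * S.outerRadius * S'.outerRadius / 2 ^ n) := by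
            simp only [nsmul_eq_mul]; push_cast; ring
        _ ≤ 1 / 2 * (2 * Real.pi * M * S.outerRadius * S'.outerRadius / 2 ^ n) := by
            exact mul_le_mul_of_nonneg_right (by norm_num) this
        _ = _ := by field_simp
    have hFg : DifferentiableOn ℂ (fun z => F z * g z) S.dom := h.differentiableOn.mul
      (hg.mono fun z hz => by simpa [dist_eq_norm] using (S.mem_dom_iff.1 hz).1)
    have hlim' := (hlim.norm.const_add
      (2 * Real.pi * M * S.outerRadius * S'.outerRadius / 2 ^ (n + 1)))
    rw [norm_zero, add_zero] at hlim'
    refine ge_of_tendsto hlim' ?_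
    filter_upwards [ht.eventually_isDilation, (Finset.eventually_all _).2 hchild] with l hl hc
    rw [hl.circleIntegral_eq_sum ht hFg, Finset.sum_sub_distrib]
    have h6 : ‖∑ j ∈ Finset.univ.erase o,
        ∮ z in C(S.center j, S.radius j / l), (S'.inv j ∘ F ∘ S.inv j) z * g z‖ ≤
        2 * Real.pi * M * S.outerRadius * S'.outerRadius / 2 ^ (n + 1) :=
      (norm_sum_le_of_le _ hc).trans hbound
    exact (norm_le_norm_add_norm_sub' _ _).trans (add_le_add_left h6 _)

theorem IsAdmissible.circleIntegral_eq_zero {o : Fin 5} {S S' : CircleConfig o}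
    {F : ℂ → ℂ} (h : IsAdmissible S S' F) {g : ℂ → ℂ} {M : ℝ}
    (hg : DifferentiableOn ℂ g (ball (S.center o) S.outerRadius))
    (hM : ∀ z ∈ ball (S.center o) S.outerRadius, ‖g z‖ ≤ M) {t : ℝ} (ht : S.Encloses t) :
    (∮ z in C(S.center o, t), F z * g z) = 0 := by
  have hlim : Tendsto (fun n : ℕ => 2 * Real.pi * M * S.outerRadius * S'.outerRadius / 2 ^ n)
      atTop (𝓝 0) :=
    tendsto_const_nhds.div_atTop (tendsto_pow_atTop_atTop_of_one_lt one_lt_two)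
  exact norm_le_zero_iff.1 (ge_of_tendsto' hlim fun n => h.norm_circleIntegral_le n hg hM ht)

/-- The integrals of an admissible map over circles shrinking to an inner circle tend to zero. -/
theorem IsAdmissible.tendsto_circleIntegral_zero {o : Fin 5} {S S' : CircleConfig o}
    {F : ℂ → ℂ} (h : IsAdmissible S S' F) {j : Fin 5} (hj : j ≠ o) {g : ℂ → ℂ} {U : Set ℂ}
    (hU : IsOpen U) (hjU : closedBall (S.center j) (S.radius j) ⊆ U)
    (hg : DifferentiableOn ℂ g U) :
    Tendsto (fun l : ℝ => ∮ z in C(S.center j, l * S.radius j), F z * g z) (𝓝[>] 1) (𝓝 0) := by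
  obtain ⟨M, hM⟩ := (isCompact_closedBall _ _).exists_bound_of_continuousOn
    (hg.continuousOn.mono hjU)
  have hM' : ∀ z ∈ ball (S.center j) (S.radius j), ‖g z‖ ≤ M :=
    fun z hz => hM z (ball_subset_closedBall hz)
  have hg' := hg.mono (ball_subset_closedBall.trans hjU)
  refine (h.tendsto_circleIntegral_sub hj hU hjU hg.continuousOn).congr' ?_
  filter_upwards [S.eventually_encloses_invert hj] with l hl
  have := (h.invert hj).circleIntegral_eq_zero (M := M) (by simpa using hg') (by simpa using hM') hl
  rw [invert_center_self] at this
  rw [this, sub_zero]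

end CircleConfig

theorem circleIntegral_dslope {f : ℂ → ℂ} {c z : ℂ} {r : ℝ} (hr : 0 ≤ r)
    (hf : ContinuousOn f (sphere c r)) (hz : z ∉ sphere c r) :
    (∮ ζ in C(c, r), dslope f z ζ) =
      (∮ ζ in C(c, r), f ζ / (ζ - z)) - ∮ ζ in C(c, r), f z / (ζ - z) := by
  have hne : ∀ ζ ∈ sphere c r, ζ - z ≠ 0 := fun ζ hζ h => hz (sub_eq_zero.1 h ▸ hζ)
  rw [← circleIntegral.integral_sub]
  · refine circleIntegral.integral_congr hr fun ζ hζ => ?_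
    rw [dslope_of_ne _ (sub_ne_zero.1 (hne ζ hζ)), slope_def_field]
    simp only [sub_div]
  · exact (hf.div (by fun_prop) hne).circleIntegrable hr
  · exact (continuousOn_const.div (by fun_prop) hne).circleIntegrable hr

namespace CircleConfig

variable {o : Fin 5} {S S' : CircleConfig o} {F : ℂ → ℂ}

theorem IsAdmissible.cauchy_formula (h : IsAdmissible S S' F) {t : ℝ} (ht : S.Encloses t) {z : ℂ}
    (hz : z ∈ S.dom) (hzt : z ∈ ball (S.center o) t) :
    (∮ ζ in C(S.center o, t), F ζ / (ζ - z)) = 2 * Real.pi * I * F z := by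
  have hd : DifferentiableOn ℂ (dslope F z) S.dom :=
    (differentiableOn_dslope (S.isOpen_dom.mem_nhds hz)).2 h.differentiableOn
  have hlim : Tendsto (fun l : ℝ => ∑ j ∈ Finset.univ.erase o,
      ∮ ζ in C(S.center j, l * S.radius j), F ζ * (ζ - z)⁻¹) (𝓝[>] 1)
      (𝓝 (∑ j ∈ Finset.univ.erase o, 0)) := by
    refine tendsto_finsetSum _ fun j hj => ?_
    have hj := Finset.ne_of_mem_erase hj
    refine h.tendsto_circleIntegral_zero hj (isOpen_compl_singleton (x := z)) ?_ ?_
    · intro ζ hζ hζz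
      rw [mem_singleton_iff.1 hζz, mem_closedBall, dist_eq_norm] at hζ
      exact hζ.not_gt ((S.mem_dom_iff.1 hz).2 j hj)
    · intro ζ hζ
      exact ((differentiableAt_id.sub_const z).inv (sub_ne_zero.2 hζ)).differentiableWithinAt
  rw [Finset.sum_const_zero] at hlim
  have hev : ∀ᶠ l in 𝓝[>] (1 : ℝ), ∀ j, j ≠ o → l * S.radius j < ‖z - S.center j‖ := by
    refine eventually_all.2 fun j => ?_
    by_cases hj : j = o
    · exact Eventually.of_forall fun l h => absurd hj h
    · filter_upwards [eventually_mul_lt ((S.mem_dom_iff.1 hz).2 j hj)] with l hl _ using hl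
  rw [← sub_eq_zero]
  refine tendsto_nhds_unique (tendsto_const_nhds.congr' ?_) hlim
  filter_upwards [hev, ht.eventually_isDilation] with l hl hdil
  have hsum := hdil.circleIntegral_eq_sum ht hd
  rw [circleIntegral_dslope ht.pos.le (h.differentiableOn.continuousOn.mono ht.sphere_subset_dom)
    fun h' => (mem_ball.1 hzt).ne (mem_sphere.1 h'), circleIntegral_const_div_sub_of_mem _ hzt]
    at hsum
  rw [hsum]
  refine Finset.sum_congr rfl fun j hj => ?_
  have hj := Finset.ne_of_mem_erase hj
  have hpos : 0 ≤ l * S.radius j :=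
    (mul_pos (one_pos.trans hdil.one_lt) (S.radius_pos j hj)).le
  have hnot : z ∉ closedBall (S.center j) (l * S.radius j) := by
    rw [mem_closedBall, dist_eq_norm]
    exact (hl j hj).not_ge
  rw [circleIntegral_dslope hpos (h.differentiableOn.continuousOn.mono
    ((hdil.sphere_subset hj).trans (hdil.diff_subset_dom ht)))
    fun h' => hnot (sphere_subset_closedBall h'), circleIntegral_const_div_sub_of_notMem _ hpos hnot,
    sub_zero]
  simp only [div_eq_mul_inv]

theorem mem_dom_or_exists_mem_closedBall {z : ℂ} (hz : z ∈ ball (S.center o) S.outerRadius) :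
    z ∈ S.dom ∨ ∃ j, j ≠ o ∧ z ∈ closedBall (S.center j) (S.radius j) := by
  by_contra! h
  refine h.1 (S.mem_dom_iff.2 ⟨by rwa [mem_ball, dist_eq_norm] at hz, fun j hj => ?_⟩)
  have := h.2 j hj
  rwa [mem_closedBall, dist_eq_norm, not_le] at this

theorem dom_subset_ball : S.dom ⊆ ball (S.center o) S.outerRadius := fun z hz => by
  rw [mem_ball, dist_eq_norm]
  exact (S.mem_dom_iff.1 hz).1

theorem IsAdmissible.exists_differentiableOn_ball (h : IsAdmissible S S' F) :
    ∃ E : ℂ → ℂ, DifferentiableOn ℂ E (ball (S.center o) S.outerRadius) ∧ EqOn E F S.dom := by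
  obtain ⟨t, ht, -⟩ := S.exists_encloses_gt S.outerRadius_pos
  set G : ℂ → ℂ := fun z => (2 * Real.pi * I)⁻¹ * ∮ ζ in C(S.center o, t), F ζ / (ζ - z) with hG
  have hpi : (2 * Real.pi * I : ℂ) ≠ 0 := two_pi_I_ne_zero
  have hGF : ∀ z ∈ S.dom, z ∈ ball (S.center o) t → G z = F z := fun z hz hzt => by
    rw [hG]
    simp only [h.cauchy_formula ht hz hzt, inv_mul_cancel_left₀ hpi]
  have hGd : DifferentiableOn ℂ G (ball (S.center o) t) := by
    refine ((circleIntegral_cauchyTransform_differentiableOn ht.pos.le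
      (h.differentiableOn.continuousOn.mono ht.sphere_subset_dom)).mono ?_).const_mul _
    exact fun z hz h' => (mem_ball.1 hz).ne (mem_sphere.1 h')
  classical
  refine ⟨fun z => if z ∈ S.dom then F z else G z, fun z hz => ?_, fun z hz => if_pos hz⟩
  refine DifferentiableAt.differentiableWithinAt ?_
  by_cases hzd : z ∈ S.dom
  · refine (h.differentiableOn.differentiableAt (S.isOpen_dom.mem_nhds hzd)).congr_of_eventuallyEq ?_
    filter_upwards [S.isOpen_dom.mem_nhds hzd] with w hw using if_pos hw
  · obtain ⟨j, hj, hzj⟩ := (mem_dom_or_exists_mem_closedBall hz).resolve_left hzd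
    have hzt : z ∈ ball (S.center o) t := by
      refine closedBall_subset_ball' ?_ hzj
      rw [dist_eq_norm]
      linarith [ht.2 j hj]
    refine (hGd.differentiableAt (isOpen_ball.mem_nhds hzt)).congr_of_eventuallyEq ?_
    filter_upwards [isOpen_ball.mem_nhds hzt] with w hw
    split_ifs with hwd
    · exact (hGF w hwd hw).symm
    · rfl

theorem IsAdmissible.eventually_norm_sub_lt (h : IsAdmissible S S' F) {j : Fin 5} (hj : j ≠ o)
    {ρ : ℝ} (hρ : S'.radius j < ρ) : ∀ᶠ l in 𝓝[>] (1 : ℝ),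
      ∀ z ∈ sphere (S.center j) (l * S.radius j), z ∈ S.dom → ‖F z - S'.center j‖ < ρ := by
  have hr := S.radius_pos j hj
  have hr' := S'.radius_pos j hj
  have hε : 0 < (ρ ^ 2 - S'.radius j ^ 2) / S'.radius j :=
    div_pos (sub_pos.2 (by gcongr)) hr'
  have h1 : ∀ᶠ z in S.boundaryEnd j, S'.power j (F z) < (ρ ^ 2 - S'.radius j ^ 2) / S'.radius j :=
    ((tendsto_comap.mono_left inf_le_left).comp (h.tendsto_boundaryEnd j)).eventually
      (gt_mem_nhds hε)
  rw [boundaryEnd, eventually_inf_principal, eventually_comap] at h1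
  have h2 : Tendsto (fun l : ℝ => ((l * S.radius j) ^ 2 - S.radius j ^ 2) / S.radius j) (𝓝[>] 1)
      (𝓝 0) := by
    have : Continuous fun l : ℝ => ((l * S.radius j) ^ 2 - S.radius j ^ 2) / S.radius j := by
      fun_prop
    have h3 := this.tendsto 1
    rw [one_mul, sub_self, zero_div] at h3
    exact h3.mono_left nhdsWithin_le_nhds
  filter_upwards [h2.eventually h1] with l hl z hz hzd
  have h4 := hl z (by
    rw [power, signedPower, normSq_eq_norm_sq, ← dist_eq_norm, mem_sphere.1 hz]) hzd
  rw [power, signedPower, div_lt_div_iff_of_pos_right hr', normSq_eq_norm_sq] at h4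
  exact lt_of_pow_lt_pow_left₀ 2 (hr'.trans hρ).le (by linarith)

variable {E : ℂ → ℂ}

theorem IsAdmissible.mapsTo_closedBall (h : IsAdmissible S S' F)
    (hE : DifferentiableOn ℂ E (ball (S.center o) S.outerRadius)) (hEF : EqOn E F S.dom)
    {j : Fin 5} (hj : j ≠ o) :
    MapsTo E (closedBall (S.center j) (S.radius j)) (closedBall (S'.center j) (S'.radius j)) := by
  intro z hz
  rw [mem_closedBall, dist_eq_norm]
  refine le_of_forall_gt_imp_ge_of_dense fun ρ hρ => ?_
  obtain ⟨t, ht, -⟩ := S.exists_encloses_gt S.outerRadius_pos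
  obtain ⟨l, hl, hd⟩ := ((h.eventually_norm_sub_lt hj hρ).and ht.eventually_isDilation).exists
  have hr := S.radius_pos j hj
  have hlr : 0 < l * S.radius j := mul_pos (one_pos.trans hd.one_lt) hr
  have hsub : closedBall (S.center j) (l * S.radius j) ⊆ ball (S.center o) S.outerRadius :=
    (hd.inner j hj).trans (ball_subset_ball ht.1.le)
  refine norm_le_of_forall_mem_frontier_norm_le (f := fun z => E z - S'.center j)
    (U := ball (S.center j) (l * S.radius j)) isBounded_ball ?_ ?_ ?_
  · refine DifferentiableOn.diffContOnCl ?_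
    rw [closure_ball _ hlr.ne']
    exact (hE.mono hsub).sub_const _
  · intro w hw
    rw [frontier_ball _ hlr.ne'] at hw
    have hwd := hd.diff_subset_dom ht (hd.sphere_subset hj hw)
    rw [hEF hwd]
    exact (hl w hw hwd).le
  · rw [closure_ball _ hlr.ne']
    exact closedBall_subset_closedBall (by nlinarith [hd.one_lt]) hz

theorem IsAdmissible.mapsTo_ball (h : IsAdmissible S S' F)
    (hE : DifferentiableOn ℂ E (ball (S.center o) S.outerRadius)) (hEF : EqOn E F S.dom) :
    MapsTo E (ball (S.center o) S.outerRadius) (ball (S'.center o) S'.outerRadius) := by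
  intro z hz
  rcases mem_dom_or_exists_mem_closedBall hz with hzd | ⟨j, hj, hzj⟩
  · rw [hEF hzd]
    exact dom_subset_ball (h.mapsTo hzd)
  · exact S'.closedBall_subset_ball_outer hj (h.mapsTo_closedBall hE hEF hj hzj)

theorem IsAdmissible.mapsTo_sphere (h : IsAdmissible S S' F)
    (hE : DifferentiableOn ℂ E (ball (S.center o) S.outerRadius)) (hEF : EqOn E F S.dom)
    {j : Fin 5} (hj : j ≠ o) :
    MapsTo E (sphere (S.center j) (S.radius j)) (sphere (S'.center j) (S'.radius j)) := by
  intro z hz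
  rw [mem_sphere]
  refine le_antisymm (h.mapsTo_closedBall hE hEF hj (sphere_subset_closedBall hz)) ?_
  have hr := S.radius_pos j hj
  obtain ⟨t, ht, -⟩ := S.exists_encloses_gt S.outerRadius_pos
  have hEc : ContinuousAt E z := hE.continuousOn.continuousAt (isOpen_ball.mem_nhds
    (S.closedBall_subset_ball_outer hj (sphere_subset_closedBall hz)))
  have hlim : Tendsto (fun l : ℝ => S.center j + l * (z - S.center j)) (𝓝[>] 1) (𝓝 z) := by
    have : Continuous fun l : ℝ => S.center j + l * (z - S.center j) := by fun_prop
    have h3 := this.tendsto 1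
    rw [ofReal_one, one_mul, add_sub_cancel] at h3
    exact h3.mono_left nhdsWithin_le_nhds
  have hlim' := ((hEc.tendsto.comp hlim).dist (tendsto_const_nhds (x := S'.center j)))
  refine ge_of_tendsto hlim' ?_
  filter_upwards [ht.eventually_isDilation] with l hd
  have hmem : S.center j + l * (z - S.center j) ∈ S.dom := by
    refine hd.diff_subset_dom ht (hd.sphere_subset hj ?_)
    rw [mem_sphere, dist_eq_norm, add_sub_cancel_left, norm_mul, norm_real, Real.norm_eq_abs,
      abs_of_pos (one_pos.trans hd.one_lt), ← dist_eq_norm, mem_sphere.1 hz]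
  rw [Function.comp_apply, hEF hmem, dist_eq_norm]
  exact ((S'.mem_dom_iff.1 (h.mapsTo hmem)).2 j hj).le

theorem dom_nonempty : S.dom.Nonempty := by
  obtain ⟨t, ht, -⟩ := S.exists_encloses_gt S.outerRadius_pos
  exact ⟨circleMap (S.center o) t 0, ht.sphere_subset_dom (circleMap_mem_sphere _ ht.pos.le _)⟩

theorem leftInvOn_ball {G : ℂ → ℂ} (hE : DifferentiableOn ℂ E (ball (S.center o) S.outerRadius))
    (hG : DifferentiableOn ℂ G (ball (S'.center o) S'.outerRadius))
    (hEm : MapsTo E (ball (S.center o) S.outerRadius) (ball (S'.center o) S'.outerRadius))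
    (h : ∀ z ∈ S.dom, G (E z) = z) :
    LeftInvOn G E (ball (S.center o) S.outerRadius) := by
  obtain ⟨z₀, hz₀⟩ := S.dom_nonempty
  refine AnalyticOnNhd.eqOn_of_preconnected_of_eventuallyEq (f := G ∘ E) (g := id)
    ((hG.comp hE hEm).analyticOnNhd isOpen_ball) analyticOnNhd_id
    (convex_ball _ _).isPreconnected (dom_subset_ball hz₀) ?_
  filter_upwards [S.isOpen_dom.mem_nhds hz₀] with z hz using h z hz

end CircleConfig

namespace CircleConfig

variable {o o' : Fin 5} {S : CircleConfig o} {S' : CircleConfig o'}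

theorem exists_gap (S : CircleConfig o) : ∃ g > 0, g ≤ S.outerRadius ∧
    ∀ j k, j ≠ k → ∀ z, S.power j z < g → g ≤ S.power k z := by
  have hlt : ∀ {x : ℝ}, 0 < x → ∀ᶠ g in 𝓝[>] (0 : ℝ), g < x := fun hx =>
    nhdsWithin_le_nhds (gt_mem_nhds hx)
  have h1 : ∀ᶠ g in 𝓝[>] (0 : ℝ), ∀ j, j ≠ o →
      g < S.outerRadius - (‖S.center j - S.center o‖ + S.radius j) := by
    refine eventually_all.2 fun j => ?_
    by_cases hj : j = o
    · exact Eventually.of_forall fun l h => absurd hj h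
    · filter_upwards [hlt (sub_pos.2 (S.norm_center_sub_add_radius_lt hj))] with l hl _ using hl
  have h2 : ∀ᶠ g in 𝓝[>] (0 : ℝ), ∀ j k, j ≠ o → k ≠ o → j ≠ k →
      g < ‖S.center j - S.center k‖ - (S.radius j + S.radius k) := by
    refine eventually_all.2 fun j => eventually_all.2 fun k => ?_
    by_cases h : j ≠ o ∧ k ≠ o ∧ j ≠ k
    · filter_upwards [hlt (sub_pos.2 (S.radius_add_radius_lt h.1 h.2.1 h.2.2))]
        with l hl _ _ _ using hl
    · exact Eventually.of_forall fun l h1 h2 h3 => absurd ⟨h1, h2, h3⟩ h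
  obtain ⟨g, hg1, hg2, hgR, hg0⟩ :=
    (h1.and (h2.and ((hlt S.outerRadius_pos).and self_mem_nhdsWithin))).exists
  have hg0 : 0 < g := hg0
  have hR := S.outerRadius_pos
  have hin : ∀ j, j ≠ o → ∀ z, S.power j z < g / 2 → ‖z - S.center j‖ ≤ S.radius j + g / 2 := by
    intro j hj z hz
    have hr := S.radius_pos j hj
    rw [power, signedPower, div_lt_iff₀ hr, normSq_eq_norm_sq] at hz
    exact le_of_sq_le_sq (by nlinarith) (by positivity)
  have hout : ∀ z, S.power o z < g / 2 → S.outerRadius - g / 2 ≤ ‖z - S.center o‖ := by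
    intro z hz
    have : S.radius o = -S.outerRadius := by rw [outerRadius, neg_neg]
    rw [power, signedPower, div_lt_iff_of_neg S.radius_outer_neg, normSq_eq_norm_sq, this] at hz
    exact le_of_sq_le_sq (by nlinarith) (norm_nonneg _)
  have hkid : ∀ k, k ≠ o → ∀ z, S.radius k + g / 2 ≤ ‖z - S.center k‖ → g / 2 ≤ S.power k z := by
    intro k hk z hz
    have hr := S.radius_pos k hk
    rw [power, signedPower, le_div_iff₀ hr, normSq_eq_norm_sq]
    nlinarith
  refine ⟨g / 2, by positivity, by linarith, fun j k hjk z hz => ?_⟩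
  by_cases hj : j = o
  · subst hj
    have hk : k ≠ j := hjk.symm
    refine hkid k hk z ?_
    have h3 := hout z hz
    have h4 := norm_add_le (z - S.center k) (S.center k - S.center j)
    rw [sub_add_sub_cancel] at h4
    linarith [hg1 k hk]
  · by_cases hk : k = o
    · subst hk
      have h3 := hin j hj z hz
      have h4 := norm_add_le (z - S.center j) (S.center j - S.center k)
      rw [sub_add_sub_cancel] at h4
      have h5 : ‖z - S.center k‖ ≤ S.outerRadius - g / 2 := by linarith [hg1 j hj]
      have : S.radius k = -S.outerRadius := by rw [outerRadius, neg_neg]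
      rw [power, signedPower, le_div_iff_of_neg S.radius_outer_neg, normSq_eq_norm_sq, this]
      nlinarith [norm_nonneg (z - S.center k)]
    · refine hkid k hk z ?_
      have h3 := hin j hj z hz
      have h4 := norm_sub_le (z - S.center k) (z - S.center j)
      rw [sub_sub_sub_cancel_left] at h4
      linarith [hg2 j k hj hk hjk]

/-- The part of the region where the power with respect to the circle `j` is less than `δ`. -/
def collar (S : CircleConfig o) (j : Fin 5) (δ : ℝ) : Set ℂ := {z | z ∈ S.dom ∧ S.power j z < δ}

theorem isOpen_collar (j : Fin 5) (δ : ℝ) : IsOpen (S.collar j δ) :=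
  S.isOpen_dom.inter (isOpen_lt (S.continuous_power j) continuous_const)

theorem collar_mono (j : Fin 5) {δ ε : ℝ} (h : δ ≤ ε) : S.collar j δ ⊆ S.collar j ε :=
  fun _ hz => ⟨hz.1, hz.2.trans_le h⟩

theorem tendsto_boundaryEnd_iff {F : ℂ → ℂ} {j k : Fin 5} :
    Tendsto F (S.boundaryEnd j) (S'.boundaryEnd k) ↔
      ∀ ε > 0, ∃ δ > 0, MapsTo F (S.collar j δ) (S'.collar k ε) := by
  have hbasis : ∀ {o : Fin 5} (S : CircleConfig o) (j : Fin 5),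
      (S.boundaryEnd j).HasBasis (fun δ : ℝ => 0 < δ) (S.collar j) := by
    intro o S j
    refine (((nhds_basis_ball (x := (0 : ℝ))).comap (S.power j)).inf_principal S.dom).congr
      (fun _ => Iff.rfl) fun δ _ => ?_
    ext z
    simp only [mem_inter_iff, mem_preimage, mem_ball, dist_zero_right, Real.norm_eq_abs, collar,
      mem_ofPred_eq]
    constructor
    · exact fun h => ⟨h.2, (le_abs_self _).trans_lt h.1⟩
    · exact fun h => ⟨by rw [abs_of_pos (h.1 j)]; exact h.2, h.1⟩
  exact (hbasis S j).tendsto_iff (hbasis S' k)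

theorem collar_eq_image {g : ℝ} (hg : ∀ j k, j ≠ k → ∀ z, S.power j z < g → g ≤ S.power k z)
    (hg0 : 0 < g) (hgR : g ≤ S.outerRadius) (j : Fin 5) {δ : ℝ} (hδ : δ ≤ g) :
    S.collar j δ = (fun p : ℝ × ℝ => circleMap (S.center j) p.1 p.2) ''
      ({s | 0 < s ∧ 0 < (s ^ 2 - S.radius j ^ 2) / S.radius j ∧
        (s ^ 2 - S.radius j ^ 2) / S.radius j < δ} ×ˢ univ) := by
  have hpow : ∀ s θ, S.power j (circleMap (S.center j) s θ) =
      (s ^ 2 - S.radius j ^ 2) / S.radius j := by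
    intro s θ
    rw [power, signedPower, normSq_eq_norm_sq, circleMap_sub_center, norm_circleMap_zero, sq_abs]
  ext z
  constructor
  · rintro ⟨hz, hzδ⟩
    have hne : z - S.center j ≠ 0 := by
      intro h0
      by_cases hj : j = o
      · subst hj
        have hR := S.outerRadius_pos
        have hrad : S.radius j = -S.outerRadius := by rw [outerRadius, neg_neg]
        rw [power, signedPower, h0, map_zero, zero_sub, hrad, neg_sq, neg_div_neg_eq,
          div_lt_iff₀ hR] at hzδ
        nlinarith
      · exact S.ne_center_of_mem_dom hj hz (sub_eq_zero.1 h0)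
    refine ⟨(‖z - S.center j‖, arg (z - S.center j)), ⟨⟨norm_pos_iff.2 hne, ?_, ?_⟩, mem_univ _⟩, ?_⟩
    · have := hz j
      rwa [power, signedPower, normSq_eq_norm_sq] at this
    · rwa [power, signedPower, normSq_eq_norm_sq] at hzδ
    · simp only [circleMap, norm_mul_exp_arg_mul_I, add_sub_cancel]
  · rintro ⟨⟨s, θ⟩, ⟨⟨-, h1, h2⟩, -⟩, rfl⟩
    have h3 := hpow s θ
    refine ⟨fun k => ?_, by rw [h3]; exact h2⟩
    by_cases hk : j = k
    · subst hk; rw [h3]; exact h1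
    · exact hg0.trans_le (hg j k hk _ (by rw [h3]; exact h2.trans_le hδ))

theorem isPreconnected_collar {g : ℝ}
    (hg : ∀ j k, j ≠ k → ∀ z, S.power j z < g → g ≤ S.power k z)
    (hg0 : 0 < g) (hgR : g ≤ S.outerRadius) (j : Fin 5) {δ : ℝ} (hδ : δ ≤ g) :
    IsPreconnected (S.collar j δ) := by
  rw [collar_eq_image hg hg0 hgR j hδ]
  refine IsPreconnected.image (IsPreconnected.prod ?_ isPreconnected_univ) _ ?_
  · refine (ordConnected_of_Ioo ?_).isPreconnected
    rintro s ⟨hs, hs1, hs2⟩ t ⟨ht, ht1, ht2⟩ - x ⟨hx1, hx2⟩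
    have h1 : s ^ 2 ≤ x ^ 2 := by nlinarith
    have h2 : x ^ 2 ≤ t ^ 2 := by nlinarith
    refine ⟨hs.trans hx1, ?_⟩
    rcases (S.radius_ne_zero j).lt_or_gt with hr | hr
    · rw [div_lt_iff_of_neg hr] at hs2 ⊢
      refine ⟨div_pos_of_neg_of_neg ?_ hr, by linarith⟩
      rcases div_pos_iff.1 ht1 with h | h <;> linarith [h.1, h.2]
    · rw [div_lt_iff₀ hr] at ht2 ⊢
      rw [div_pos_iff_of_pos_right hr] at hs1 ⊢
      exact ⟨by linarith, by linarith⟩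
  · refine Continuous.continuousOn ?_
    unfold circleMap
    fun_prop

theorem nonempty_collar {g : ℝ}
    (hg : ∀ j k, j ≠ k → ∀ z, S.power j z < g → g ≤ S.power k z)
    (hg0 : 0 < g) (hgR : g ≤ S.outerRadius) (j : Fin 5) {δ : ℝ} (hδ0 : 0 < δ) (hδ : δ ≤ g) :
    (S.collar j δ).Nonempty := by
  rw [collar_eq_image hg hg0 hgR j hδ]
  have hr := S.radius_ne_zero j
  have hpos : 0 < S.radius j ^ 2 + δ / 2 * S.radius j := by
    by_cases hj : j = o
    · subst hj
      have hR := S.outerRadius_pos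
      have hrad : S.radius j = -S.outerRadius := by rw [outerRadius, neg_neg]
      rw [hrad]
      nlinarith
    · have := S.radius_pos j hj
      positivity
  have e : (S.radius j ^ 2 + δ / 2 * S.radius j - S.radius j ^ 2) / S.radius j = δ / 2 := by
    field_simp
    ring
  refine Nonempty.image _ (Nonempty.prod ⟨√(S.radius j ^ 2 + δ / 2 * S.radius j),
    Real.sqrt_pos.2 hpos, ?_⟩ univ_nonempty)
  rw [Real.sq_sqrt hpos.le, e]
  exact ⟨by positivity, by linarith⟩

theorem eq_of_mem_collar {g : ℝ} (hg : ∀ j k, j ≠ k → ∀ z, S.power j z < g → g ≤ S.power k z)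
    {j k : Fin 5} {δ ε : ℝ} (hδ : δ ≤ g) (hε : ε ≤ g) {z : ℂ} (hj : z ∈ S.collar j δ)
    (hk : z ∈ S.collar k ε) : j = k := by
  by_contra h
  linarith [hg j k h z (hj.2.trans_le hδ), hk.2]

theorem isCompact_setOf_le_power {ε : ℝ} (hε : 0 < ε) :
    IsCompact {z | ∀ j, ε ≤ S.power j z} := by
  refine isCompact_of_isClosed_isBounded ?_ ?_
  · have : {z | ∀ j, ε ≤ S.power j z} = ⋂ j, {z | ε ≤ S.power j z} := by ext; simp
    rw [this]
    exact isClosed_iInter fun j => isClosed_le continuous_const (S.continuous_power j)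
  · refine isBounded_ball.subset (t := ball (S.center o) S.outerRadius) fun z hz => ?_
    rw [mem_ball_iff_norm]
    exact S.power_outer_pos_iff.1 (hε.trans_le (hz o))

theorem exists_tendsto_boundaryEnd {F G : ℂ → ℂ} (hF : ContinuousOn F S.dom)
    (hG : ContinuousOn G S'.dom) (hFm : MapsTo F S.dom S'.dom) (hGm : MapsTo G S'.dom S.dom)
    (hGF : LeftInvOn G F S.dom) (j : Fin 5) :
    ∃ k, Tendsto F (S.boundaryEnd j) (S'.boundaryEnd k) := by
  obtain ⟨g, hg0, hgR, hg⟩ := S.exists_gap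
  obtain ⟨g', hg0', -, hg'⟩ := S'.exists_gap
  have key : ∀ ε, 0 < ε → ε ≤ g' → ∃ δ, 0 < δ ∧ δ ≤ g ∧
      ∃ k, MapsTo F (S.collar j δ) (S'.collar k ε) := by
    intro ε hε hεg
    obtain ⟨δ, hδ0, hδg, hδ⟩ : ∃ δ, 0 < δ ∧ δ ≤ g ∧
        ∀ w, (∀ k, ε ≤ S'.power k w) → δ ≤ S.power j (G w) := by
      have hK := S'.isCompact_setOf_le_power hε
      have hKd : {w | ∀ k, ε ≤ S'.power k w} ⊆ S'.dom := fun w hw k => hε.trans_le (hw k)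
      rcases eq_empty_or_nonempty {w | ∀ k, ε ≤ S'.power k w} with h | h
      · exact ⟨g, hg0, le_rfl, fun w hw => absurd (h ▸ hw : w ∈ (∅ : Set ℂ)) (notMem_empty w)⟩
      · obtain ⟨w, hw, hmin⟩ := hK.exists_isMinOn h
          ((S.continuous_power j).comp_continuousOn (hG.mono hKd))
        exact ⟨min g (S.power j (G w)), lt_min hg0 (hGm (hKd hw) j), min_le_left _ _,
          fun w' hw' => (min_le_right _ _).trans (hmin hw')⟩
    obtain ⟨z₀, hz₀⟩ := nonempty_collar hg hg0 hgR j hδ0 hδg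
    have hcov : ∀ z ∈ S.collar j δ, ∃ k, F z ∈ S'.collar k ε := by
      intro z hz
      by_contra! hcon
      have h1 := hδ (F z) fun k => not_lt.1 fun hk => hcon k ⟨hFm hz.1, hk⟩
      rw [hGF hz.1] at h1
      exact absurd hz.2 (not_lt.2 h1)
    obtain ⟨k, hk⟩ := hcov z₀ hz₀
    refine ⟨δ, hδ0, hδg, k, ?_⟩
    have hpre := (isPreconnected_collar hg hg0 hgR j hδg).image F
      (hF.mono fun z hz => hz.1)
    refine mapsTo_iff_image_subset.2 (hpre.subset_left_of_subset_union
      (v := ⋃ l ∈ {l | l ≠ k}, S'.collar l ε)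
      (isOpen_collar k ε) (isOpen_biUnion fun l _ => isOpen_collar l ε) ?_ ?_
      ⟨F z₀, mem_image_of_mem F hz₀, hk⟩)
    · refine disjoint_left.2 fun w hw hw' => ?_
      obtain ⟨l, hl, hwl⟩ := mem_iUnion₂.1 hw'
      exact hl (eq_of_mem_collar hg' hεg hεg hwl hw)
    · rintro _ ⟨z, hz, rfl⟩
      obtain ⟨l, hl⟩ := hcov z hz
      by_cases hlk : l = k
      · exact Or.inl (hlk ▸ hl)
      · exact Or.inr (mem_iUnion₂.2 ⟨l, hlk, hl⟩)
  obtain ⟨δ₀, hδ₀, hδ₀g, k, hk⟩ := key g' hg0' le_rfl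
  refine ⟨k, tendsto_boundaryEnd_iff.2 fun ε hε => ?_⟩
  obtain ⟨δ, hδ0, hδg, l, hl⟩ := key (min ε g') (lt_min hε hg0') (min_le_right _ _)
  obtain ⟨z, hz⟩ := nonempty_collar hg hg0 hgR j (lt_min hδ₀ hδ0)
    ((min_le_left _ _).trans hδ₀g)
  have hlk : k = l := eq_of_mem_collar hg' le_rfl (min_le_right ε g')
    (hk (collar_mono j (min_le_left _ _) hz)) (hl (collar_mono j (min_le_right _ _) hz))
  exact ⟨δ, hδ0, hlk ▸ hl.mono_right (collar_mono l (min_le_left _ _))⟩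

/-- A homeomorphism between two circular regions permutes their boundary circles. -/
theorem exists_perm_tendsto_boundaryEnd {F G : ℂ → ℂ} (hF : ContinuousOn F S.dom)
    (hG : ContinuousOn G S'.dom) (hFm : MapsTo F S.dom S'.dom) (hGm : MapsTo G S'.dom S.dom)
    (hGF : LeftInvOn G F S.dom) (hFG : LeftInvOn F G S'.dom) :
    ∃ σ : Equiv.Perm (Fin 5), ∀ j, Tendsto F (S.boundaryEnd j) (S'.boundaryEnd (σ j)) ∧
      Tendsto G (S'.boundaryEnd (σ j)) (S.boundaryEnd j) := by
  have huniq : ∀ {o : Fin 5} {S : CircleConfig o} {H : ℂ → ℂ} {j k : Fin 5}, EqOn H id S.dom →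
      Tendsto H (S.boundaryEnd j) (S.boundaryEnd k) → k = j := by
    intro o S H j k hH h
    obtain ⟨g, hg0, hgR, hg⟩ := S.exists_gap
    obtain ⟨δ, hδ0, hδ⟩ := tendsto_boundaryEnd_iff.1 h g hg0
    obtain ⟨z, hz⟩ := nonempty_collar hg hg0 hgR j (lt_min hδ0 hg0) (min_le_right δ g)
    have h1 := hδ (collar_mono j (min_le_left _ _) hz)
    rw [hH hz.1] at h1
    exact eq_of_mem_collar hg le_rfl (min_le_right δ g) h1 hz
  choose s hs using exists_tendsto_boundaryEnd hF hG hFm hGm hGF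
  choose t ht using exists_tendsto_boundaryEnd hG hF hGm hFm hFG
  have hts : ∀ j, t (s j) = j := fun j => huniq hGF ((ht (s j)).comp (hs j))
  have hst : ∀ j, s (t j) = j := fun j => huniq hFG ((hs (t j)).comp (ht j))
  refine ⟨⟨s, t, hts, hst⟩, fun j => ⟨hs j, ?_⟩⟩
  have := ht (s j)
  rwa [hts] at this

end CircleConfig

/-- The inverse of an injective holomorphic map is holomorphic. -/
theorem differentiableOn_of_invOn {U V : Set ℂ} {f g : ℂ → ℂ} (hU : IsOpen U) (hV : IsOpen V)
    (hf : DifferentiableOn ℂ f U) (hgm : MapsTo g V U)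
    (hgf : LeftInvOn g f U) (hfg : LeftInvOn f g V) : DifferentiableOn ℂ g V := by
  have hcst : ∀ z ∈ U, ∀ a, ¬ ∀ᶠ y in 𝓝 z, f y = a := by
    intro z hz a h
    have h1 : ∀ᶠ y in 𝓝[≠] z, y ∈ U ∧ f y = a :=
      nhdsWithin_le_nhds ((hU.eventually_mem hz).and h)
    obtain ⟨y, ⟨hyU, hy⟩, hyz⟩ := (h1.and self_mem_nhdsWithin).exists
    have h2 := h.self_of_nhds
    exact hyz (hgf.injOn hyU hz (hy.trans h2.symm))
  have hcont : ∀ w ∈ V, ContinuousAt g w := by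
    intro w hw
    have hz := hgm hw
    have hfw := hfg hw
    refine fun N hN => ?_
    have hN' : N ∩ U ∈ 𝓝 (g w) := inter_mem hN (hU.mem_nhds hz)
    have han := hf.analyticAt (hU.mem_nhds hz)
    have h1 := han.eventually_constant_or_nhds_le_map_nhds.resolve_left (hcst _ hz _)
    rw [hfw] at h1
    have h2 := h1 (image_mem_map hN')
    refine mem_map.2 (mem_of_superset h2 ?_)
    rintro _ ⟨y, hy, rfl⟩
    rw [mem_preimage, hgf hy.2]
    exact hy.1
  intro w hw
  have hz := hgm hw
  have hdan : AnalyticAt ℂ (deriv f) (g w) := (hf.analyticAt (hU.mem_nhds hz)).deriv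
  have hd0 : ∀ᶠ z in 𝓝[≠] (g w), deriv f z ≠ 0 := by
    refine hdan.eventually_eq_zero_or_eventually_ne_zero.resolve_left fun h0 => ?_
    obtain ⟨ε, hε, hball⟩ := Metric.eventually_nhds_iff_ball.1 (h0.and (hU.eventually_mem hz))
    refine hcst _ hz (f (g w)) (Metric.eventually_nhds_iff_ball.2 ⟨ε, hε, fun y hy => ?_⟩)
    exact isOpen_ball.is_const_of_deriv_eq_zero (convex_ball _ _).isPreconnected
      (hf.mono fun y hy => (hball y hy).2) (fun y hy => (hball y hy).1) hy (mem_ball_self hε)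
  have hev : ∀ᶠ v in 𝓝[≠] w, DifferentiableAt ℂ g v := by
    have h1 : Tendsto g (𝓝[≠] w) (𝓝[≠] (g w)) := by
      refine tendsto_nhdsWithin_iff.2 ⟨(hcont w hw).tendsto.mono_left nhdsWithin_le_nhds, ?_⟩
      filter_upwards [nhdsWithin_le_nhds (hV.mem_nhds hw), self_mem_nhdsWithin] with v hv hvw h
      exact hvw (hfg.injOn hv hw h)
    filter_upwards [h1.eventually hd0, nhdsWithin_le_nhds (hV.mem_nhds hw)] with v hv hvV
    refine HasDerivAt.differentiableAt (HasDerivAt.of_local_left_inverse (hcont v hvV)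
      (hf.differentiableAt (hU.mem_nhds (hgm hvV))).hasDerivAt hv ?_)
    filter_upwards [hV.mem_nhds hvV] with y hy using hfg hy
  exact (analyticAt_of_differentiable_on_punctured_nhds_of_continuousAt hev
    (hcont w hw)).differentiableAt.differentiableWithinAt

theorem circleInversion_conj (c : ℂ) (r : ℝ) (z : ℂ) :
    (starRingEnd ℂ) (circleInversion c r z) = (starRingEnd ℂ) c + r ^ 2 / (z - c) := by
  rw [circleInversion_eq_div]
  simp

theorem circleInversion_apply_conj (c : ℂ) (r : ℝ) (z : ℂ) :
    circleInversion c r ((starRingEnd ℂ) z) = c + r ^ 2 / (z - (starRingEnd ℂ) c) := by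
  rw [circleInversion_eq_div]
  simp

namespace CircleConfig

variable {o o' : Fin 5}

/-- Relabel the circles of a configuration. -/
def permute (S : CircleConfig o) (σ : Equiv.Perm (Fin 5)) (h : σ o' = o) : CircleConfig o' where
  center j := S.center (σ j)
  radius j := S.radius (σ j)
  radius_outer_neg := h ▸ S.radius_outer_neg
  radius_pos j hj := S.radius_pos _ fun h' => hj (σ.injective (h'.trans h.symm))
  radius_le j hj := by
    rw [h]
    exact S.radius_le _ fun h' => hj (σ.injective (h'.trans h.symm))
  separated j k hjk := S.separated _ _ (σ.injective.ne hjk)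

theorem dom_permute (S : CircleConfig o) (σ : Equiv.Perm (Fin 5)) (h : σ o' = o) :
    (S.permute σ h).dom = S.dom := by
  ext z
  exact (σ.surjective.forall (p := fun j => 0 < S.power j z)).symm

theorem boundaryEnd_permute (S : CircleConfig o) (σ : Equiv.Perm (Fin 5)) (h : σ o' = o)
    (j : Fin 5) : (S.permute σ h).boundaryEnd j = S.boundaryEnd (σ j) := by
  rw [boundaryEnd, dom_permute]
  rfl

/-- The complex conjugate of a configuration. -/
noncomputable def conjugate (S : CircleConfig o) : CircleConfig o where
  center j := (starRingEnd ℂ) (S.center j)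
  radius := S.radius
  radius_outer_neg := S.radius_outer_neg
  radius_pos := S.radius_pos
  radius_le := S.radius_le
  separated j k hjk := by
    have := S.separated j k hjk
    rwa [inversiveProduct, ← normSq_conj, map_sub] at this

theorem power_conjugate_conj (S : CircleConfig o) (j : Fin 5) (z : ℂ) :
    S.conjugate.power j ((starRingEnd ℂ) z) = S.power j z := by
  simp only [power, signedPower, conjugate]
  rw [← map_sub, normSq_conj]

theorem power_conj (S : CircleConfig o) (j : Fin 5) (z : ℂ) :
    S.power j ((starRingEnd ℂ) z) = S.conjugate.power j z := by
  rw [← power_conjugate_conj, conj_conj]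

theorem tendsto_conj (S : CircleConfig o) (j : Fin 5) :
    Tendsto (starRingEnd ℂ) (S.boundaryEnd j) (S.conjugate.boundaryEnd j) :=
  tendsto_boundaryEnd_of_power_le (K := 1)
    (fun z hz k => by rw [power_conjugate_conj]; exact hz k)
    fun z _ => by rw [power_conjugate_conj, one_mul]

theorem tendsto_conj_conjugate (S : CircleConfig o) (j : Fin 5) :
    Tendsto (starRingEnd ℂ) (S.conjugate.boundaryEnd j) (S.boundaryEnd j) :=
  tendsto_boundaryEnd_of_power_le (K := 1)
    (fun z hz k => by rw [power_conj]; exact hz k)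
    fun z _ => by rw [power_conj, one_mul]

/-- A pair of mutually inverse admissible maps. -/
structure IsAdmissiblePair (S S' : CircleConfig o) (F G : ℂ → ℂ) : Prop where
  left : IsAdmissible S S' F
  right : IsAdmissible S' S G
  left_inv : LeftInvOn G F S.dom
  right_inv : LeftInvOn F G S'.dom

variable {S S' : CircleConfig o} {F G : ℂ → ℂ}

theorem IsAdmissiblePair.exists_extension (h : IsAdmissiblePair S S' F G) :
    ∃ E H : ℂ → ℂ, EqOn E F S.dom ∧
      DifferentiableOn ℂ E (ball (S.center o) S.outerRadius) ∧
      DifferentiableOn ℂ H (ball (S'.center o) S'.outerRadius) ∧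
      MapsTo E (ball (S.center o) S.outerRadius) (ball (S'.center o) S'.outerRadius) ∧
      MapsTo H (ball (S'.center o) S'.outerRadius) (ball (S.center o) S.outerRadius) ∧
      LeftInvOn H E (ball (S.center o) S.outerRadius) ∧
      LeftInvOn E H (ball (S'.center o) S'.outerRadius) ∧
      ∀ j, j ≠ o →
        MapsTo E (closedBall (S.center j) (S.radius j)) (closedBall (S'.center j) (S'.radius j)) ∧
        MapsTo E (sphere (S.center j) (S.radius j)) (sphere (S'.center j) (S'.radius j)) := by
  obtain ⟨E, hE, hEF⟩ := h.left.exists_differentiableOn_ball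
  obtain ⟨H, hH, hHG⟩ := h.right.exists_differentiableOn_ball
  have hEm := h.left.mapsTo_ball hE hEF
  have hHm := h.right.mapsTo_ball hH hHG
  refine ⟨E, H, hEF, hE, hH, hEm, hHm, leftInvOn_ball hE hH hEm fun z hz => ?_,
    leftInvOn_ball hH hE hHm fun z hz => ?_, fun j hj =>
    ⟨h.left.mapsTo_closedBall hE hEF hj, h.left.mapsTo_sphere hE hEF hj⟩⟩
  · rw [hEF hz, hHG (h.left.mapsTo hz), h.left_inv hz]
  · rw [hHG hz, hEF (h.right.mapsTo hz), h.right_inv hz]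

/-- A pair of mutually inverse holomorphic maps that exchanges the outer circle with an inner
circle `m` becomes admissible after inversion in `m` and complex conjugation. -/
theorem isAdmissiblePair_of_outer_ne (hF : DifferentiableOn ℂ F S.dom)
    (hG : DifferentiableOn ℂ G S'.dom) (hFm : MapsTo F S.dom S'.dom) (hGm : MapsTo G S'.dom S.dom)
    (hGF : LeftInvOn G F S.dom) (hFG : LeftInvOn F G S'.dom) {σ : Equiv.Perm (Fin 5)}
    (hσ : ∀ j, Tendsto F (S.boundaryEnd j) (S'.boundaryEnd (σ j)) ∧
      Tendsto G (S'.boundaryEnd (σ j)) (S.boundaryEnd j)) {m : Fin 5} (hσo : σ o = m)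
    (hm : m ≠ o) :
    IsAdmissiblePair S (((S'.invert hm).permute σ hσo).conjugate)
      (starRingEnd ℂ ∘ S'.inv m ∘ F) (G ∘ S'.inv m ∘ starRingEnd ℂ) := by
  have hmem : ∀ w, w ∈ ((S'.invert hm).permute σ hσo).conjugate.dom ↔
      (starRingEnd ℂ) w ∈ (S'.invert hm).dom := by
    intro w
    rw [← dom_permute _ σ hσo]
    exact forall_congr' fun j => by rw [power_conj]
  refine ⟨⟨?_, ?_, ?_⟩, ⟨?_, ?_, ?_⟩, ?_, ?_⟩
  · intro z hz
    rw [hmem, Function.comp_apply, conj_conj]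
    exact S'.inv_mem_dom_invert hm (hFm hz)
  · intro z hz
    have e : starRingEnd ℂ ∘ S'.inv m ∘ F = fun z => (starRingEnd ℂ) (S'.center m) +
        S'.radius m ^ 2 / (F z - S'.center m) := by
      ext1 z
      exact circleInversion_conj _ _ _
    rw [e]
    have h1 : DifferentiableWithinAt ℂ (fun z => F z - S'.center m) S.dom z :=
      (hF z hz).sub_const _
    exact ((differentiableWithinAt_const _).div h1
      (sub_ne_zero.2 (S'.ne_center_of_mem_dom hm (hFm hz)))).const_add _
  · intro j
    refine (tendsto_conj _ j).comp ?_
    rw [boundaryEnd_permute]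
    exact (S'.tendsto_inv_boundaryEnd hm (σ j)).comp (hσ j).1
  · intro w hw
    exact hGm (S'.inv_mem_dom hm ((hmem w).1 hw))
  · intro w hw
    have hw' := (hmem w).1 hw
    have hne : w - (starRingEnd ℂ) (S'.center m) ≠ 0 := by
      intro h
      refine S'.ne_center_of_mem_dom_invert hm hw' ?_
      rw [sub_eq_zero.1 h, conj_conj]
    have hd : DifferentiableAt ℂ (S'.inv m ∘ starRingEnd ℂ) w := by
      have e : S'.inv m ∘ starRingEnd ℂ = fun z => S'.center m +
          S'.radius m ^ 2 / (z - (starRingEnd ℂ) (S'.center m)) := by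
        ext1 z
        exact circleInversion_apply_conj _ _ _
      rw [e]
      fun_prop (disch := exact hne)
    exact ((hG.differentiableAt (S'.isOpen_dom.mem_nhds (S'.inv_mem_dom hm hw'))).comp w
      hd).differentiableWithinAt
  · intro j
    have h1 := tendsto_conj_conjugate ((S'.invert hm).permute σ hσo) j
    rw [boundaryEnd_permute] at h1
    exact (hσ j).2.comp ((S'.tendsto_inv_boundaryEnd_invert hm (σ j)).comp h1)
  · intro z hz
    simp only [Function.comp_apply, conj_conj]
    rw [S'.inv_inv (S'.ne_center_of_mem_dom hm (hFm hz)), hGF hz]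
  · intro w hw
    have hw' := (hmem w).1 hw
    simp only [Function.comp_apply]
    rw [hFG (S'.inv_mem_dom hm hw'), S'.inv_inv (S'.ne_center_of_mem_dom_invert hm hw'),
      conj_conj]

theorem isAdmissiblePair_of_outer_eq (hF : DifferentiableOn ℂ F S.dom)
    (hG : DifferentiableOn ℂ G S'.dom) (hFm : MapsTo F S.dom S'.dom) (hGm : MapsTo G S'.dom S.dom)
    (hGF : LeftInvOn G F S.dom) (hFG : LeftInvOn F G S'.dom) {σ : Equiv.Perm (Fin 5)}
    (hσ : ∀ j, Tendsto F (S.boundaryEnd j) (S'.boundaryEnd (σ j)) ∧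
      Tendsto G (S'.boundaryEnd (σ j)) (S.boundaryEnd j)) (hσo : σ o = o) :
    IsAdmissiblePair S (S'.permute σ hσo) F G := by
  refine ⟨⟨?_, hF, fun j => ?_⟩, ⟨?_, ?_, fun j => ?_⟩, hGF, ?_⟩
  · rwa [dom_permute]
  · rw [boundaryEnd_permute]; exact (hσ j).1
  · rwa [dom_permute]
  · rwa [dom_permute]
  · rw [boundaryEnd_permute]; exact (hσ j).2
  · rwa [dom_permute]

end CircleConfig

namespace CircleConfig

/-- The five boundary circles of the domain with four holes. -/
noncomputable def fourHoles : CircleConfig 0 where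
  center := ![0, 1 / 2, -1 / 2, I / 2, -I / 2]
  radius := ![-1, 1 / 10, 1 / 10, 1 / 10, 1 / 10]
  radius_outer_neg := by simp
  radius_pos j hj := by fin_cases j <;> first | exact absurd rfl hj | norm_num
  radius_le j hj := by
    fin_cases j <;> first | exact absurd rfl hj | norm_num
  separated j k hjk := by
    fin_cases j <;> fin_cases k <;> first | exact absurd rfl hjk |
      norm_num [inversiveProduct, normSq_apply]

theorem fourHoles_outerRadius : fourHoles.outerRadius = 1 := neg_neg _

theorem fourHoles_center_outer : fourHoles.center 0 = 0 := rfl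

theorem fourHoles_radius {j : Fin 5} (hj : j ≠ 0) : fourHoles.radius j = 1 / 10 := by
  fin_cases j <;> first | exact absurd rfl hj | rfl

theorem norm_fourHoles_center {j : Fin 5} (hj : j ≠ 0) : ‖fourHoles.center j‖ = 1 / 2 := by
  fin_cases j <;> first | exact absurd rfl hj | norm_num [fourHoles]

theorem exists_fourHoles_center_eq {j : Fin 5} (hj : j ≠ 0) :
    ∃ k : Fin 4, fourHoles.center j = I ^ (k : ℕ) / 2 := by
  fin_cases j
  · exact absurd rfl hj
  · exact ⟨0, by simp [fourHoles]⟩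
  · exact ⟨2, by simp [fourHoles]⟩
  · exact ⟨1, by simp [fourHoles]⟩
  · exact ⟨3, by simp [fourHoles, I_pow_three]⟩

theorem le_normSq_fourHoles_center_sub {j k : Fin 5} (hj : j ≠ 0) (hk : k ≠ 0) (hjk : j ≠ k) :
    1 / 2 ≤ normSq (fourHoles.center j - fourHoles.center k) := by
  fin_cases j <;> fin_cases k <;>
    first | exact absurd rfl hj | exact absurd rfl hk | exact absurd rfl hjk |
      norm_num [fourHoles, normSq_apply]

theorem dom_fourHoles : fourHoles.dom = FourHoleDomain := by
  ext z
  rw [mem_dom_iff, fourHoles_outerRadius]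
  simp [Fin.forall_fin_succ, fourHoles, FourHoleDomain, dist_eq_norm]
  tauto

end CircleConfig

namespace CircleConfig

variable {o : Fin 5} {S S' : CircleConfig o} {F G : ℂ → ℂ}

/-- The Schwarz lemma bounds the radii of the inner circles under an admissible pair. -/
theorem IsAdmissiblePair.radius_mul_le (h : IsAdmissiblePair S S' F G) {j : Fin 5} (hj : j ≠ o) :
    S.radius j * (S'.outerRadius - ‖S'.center j - S'.center o‖) ≤
      2 * S.outerRadius * S'.radius j := by
  obtain ⟨E, H, -, -, hH, -, hHm, hHE, -, hEj⟩ := h.exists_extension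
  have hr := S.radius_pos j hj
  have hr' := S'.radius_pos j hj
  have hρ := S'.norm_center_sub_add_radius_lt hj
  set ρ := S'.outerRadius - ‖S'.center j - S'.center o‖ with hρdef
  have hρ0 : 0 < ρ := by linarith
  have hsub : ball (S'.center j) ρ ⊆ ball (S'.center o) S'.outerRadius :=
    ball_subset_ball' (by rw [dist_eq_norm]; linarith)
  have hc := hHm (hsub (mem_ball_self hρ0))
  have hmaps : MapsTo H (ball (S'.center j) ρ)
      (closedBall (H (S'.center j)) (2 * S.outerRadius)) := by
    intro w hw
    have h1 := hHm (hsub hw)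
    rw [mem_ball] at h1 hc
    have h2 := dist_triangle_right (H w) (H (S'.center j)) (S.center o)
    rw [mem_closedBall]
    linarith
  have hbound : ∀ z ∈ closedBall (S.center j) (S.radius j),
      dist z (H (S'.center j)) ≤ 2 * S.outerRadius / ρ * S'.radius j := by
    intro z hz
    have h1 := (hEj j hj).1 hz
    have h2 := dist_le_div_mul_dist_of_mapsTo_ball (hH.mono hsub) hmaps (z := E z)
      (closedBall_subset_ball (by linarith) h1)
    rw [hHE (S.closedBall_subset_ball_outer hj hz)] at h2
    have hR := S.outerRadius_pos
    exact h2.trans (mul_le_mul_of_nonneg_left h1 (by positivity))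
  have h1 := hbound (S.center j + S.radius j) (by simp [abs_of_pos hr])
  have h2 := hbound (S.center j - S.radius j) (by simp [abs_of_pos hr])
  have h3 := dist_triangle_right (S.center j + S.radius j) (S.center j - S.radius j)
    (H (S'.center j))
  have h4 : dist (S.center j + S.radius j) (S.center j - S.radius j) = 2 * S.radius j := by
    rw [dist_eq_norm]
    have : S.center j + S.radius j - (S.center j - S.radius j) = ((2 * S.radius j : ℝ) : ℂ) := by
      push_cast; ring
    rw [this, norm_real, Real.norm_eq_abs, abs_of_pos (by positivity)]
  rw [h4] at h3
  have h5 : S.radius j ≤ 2 * S.outerRadius / ρ * S'.radius j := by linarith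
  rw [div_mul_eq_mul_div, le_div_iff₀ hρ0] at h5
  exact h5

theorem not_isAdmissiblePair_fourHoles_invert {m : Fin 5} (hm : m ≠ 0)
    {σ : Equiv.Perm (Fin 5)} (hσ : σ 0 = m) :
    ¬ IsAdmissiblePair fourHoles (((fourHoles.invert hm).permute σ hσ).conjugate) F G := by
  intro h
  obtain ⟨j, hj, hσj⟩ : ∃ j, j ≠ 0 ∧ σ j ≠ 0 := by
    by_cases h1 : σ 1 = 0
    · exact ⟨2, by decide, fun h2 => absurd (σ.injective (h1.trans h2.symm)) (by decide)⟩
    · exact ⟨1, by decide, h1⟩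
  have hσm : σ j ≠ m := fun h' => hj (σ.injective (h'.trans hσ.symm))
  have key := h.radius_mul_le hj
  have hN := le_normSq_fourHoles_center_sub hσj hm hσm
  have e1 : ((fourHoles.invert hm).permute σ hσ).conjugate.outerRadius = 1 / 10 := by
    change -((fourHoles.invert hm).radius (σ 0)) = 1 / 10
    rw [hσ]
    exact (fourHoles.invert_outerRadius hm).trans (fourHoles_radius hm)
  have e2 : ((fourHoles.invert hm).permute σ hσ).conjugate.radius j =
      1 / 1000 / (normSq (fourHoles.center (σ j) - fourHoles.center m) - 1 / 100) := by
    change (fourHoles.invert hm).radius (σ j) = _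
    rw [invert_radius, centerPower, fourHoles_radius hm, fourHoles_radius hσj]
    norm_num
  have e3 : ‖((fourHoles.invert hm).permute σ hσ).conjugate.center j -
      ((fourHoles.invert hm).permute σ hσ).conjugate.center 0‖ =
      1 / 100 / (normSq (fourHoles.center (σ j) - fourHoles.center m) - 1 / 100) *
        ‖fourHoles.center (σ j) - fourHoles.center m‖ := by
    change ‖(starRingEnd ℂ) ((fourHoles.invert hm).center (σ j)) -
      (starRingEnd ℂ) ((fourHoles.invert hm).center (σ 0))‖ = _
    rw [← map_sub, norm_conj, hσ, invert_center_self, invert_center, add_sub_cancel_left,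
      centerPower, fourHoles_radius hm, fourHoles_radius hσj, norm_mul, norm_real,
      Real.norm_of_nonneg]
    · norm_num
    · exact div_nonneg (by norm_num) (by norm_num; linarith)
  rw [e1, e2, e3, fourHoles_outerRadius, fourHoles_radius hj] at key
  rw [normSq_eq_norm_sq] at key hN
  set d := ‖fourHoles.center (σ j) - fourHoles.center m‖
  have hd0 : 0 ≤ d := norm_nonneg _
  have hd : 7 / 10 ≤ d := by nlinarith
  have hpos : 0 < d ^ 2 - 1 / 100 := by linarith
  rw [mul_div_assoc', le_div_iff₀ hpos] at key
  have e4 : 1 / 10 * (1 / 10 - 1 / 100 / (d ^ 2 - 1 / 100) * d) * (d ^ 2 - 1 / 100) =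
      1 / 100 * (d ^ 2 - 1 / 100) - 1 / 1000 * d := by
    generalize d ^ 2 - 1 / 100 = x at hpos ⊢
    field_simp
    ring
  rw [e4] at key
  nlinarith

end CircleConfig

theorem normSq_one_sub_conj_mul_sub (a w : ℂ) :
    normSq (1 - (starRingEnd ℂ) a * w) - normSq (w - a) = (1 - normSq a) * (1 - normSq w) := by
  simp [normSq_apply]
  ring

theorem one_sub_conj_mul_ne_zero {a w : ℂ} (ha : ‖a‖ < 1) (hw : ‖w‖ < 1) :
    1 - (starRingEnd ℂ) a * w ≠ 0 := by
  intro h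
  have h1 := norm_mul_le ((starRingEnd ℂ) a) w
  rw [← sub_eq_zero.1 h, norm_one, norm_conj] at h1
  nlinarith [norm_nonneg a, norm_nonneg w]

theorem norm_sub_div_one_sub_conj_mul_lt_one {a w : ℂ} (ha : ‖a‖ < 1) (hw : ‖w‖ < 1) :
    ‖(w - a) / (1 - (starRingEnd ℂ) a * w)‖ < 1 := by
  rw [norm_div, div_lt_one (norm_pos_iff.2 (one_sub_conj_mul_ne_zero ha hw))]
  refine lt_of_pow_lt_pow_left₀ 2 (norm_nonneg _) ?_
  have h := normSq_one_sub_conj_mul_sub a w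
  simp only [normSq_eq_norm_sq] at h
  have h1 : 0 < (1 - ‖a‖ ^ 2) * (1 - ‖w‖ ^ 2) := by
    apply mul_pos <;> nlinarith [norm_nonneg a, norm_nonneg w]
  linarith

/-- The holomorphic automorphisms of the unit disc are Möbius maps. -/
theorem exists_mul_eq_of_leftInvOn_ball {E H : ℂ → ℂ} (hE : DifferentiableOn ℂ E (ball 0 1))
    (hH : DifferentiableOn ℂ H (ball 0 1)) (hEm : MapsTo E (ball 0 1) (ball 0 1))
    (hHm : MapsTo H (ball 0 1) (ball 0 1)) (hHE : LeftInvOn H E (ball 0 1)) :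
    ∃ u : ℂ, ‖u‖ = 1 ∧ ∀ z ∈ ball (0 : ℂ) 1,
      E z * (1 + (starRingEnd ℂ) (E 0) * (u * z)) = u * z + E 0 := by
  have h0 : (0 : ℂ) ∈ ball (0 : ℂ) 1 := mem_ball_self one_pos
  obtain ⟨a, ha⟩ : ∃ a, a = E 0 := ⟨_, rfl⟩
  have ha1 : ‖a‖ < 1 := by
    rw [ha]
    exact mem_ball_zero_iff.1 (hEm h0)
  rw [← ha]
  set f : ℂ → ℂ := fun z => (E z - a) / (1 - (starRingEnd ℂ) a * E z)
  set b : ℂ → ℂ := fun w => (w + a) / (1 + (starRingEnd ℂ) a * w)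
  have hden : ∀ z ∈ ball (0 : ℂ) 1, 1 - (starRingEnd ℂ) a * E z ≠ 0 := fun z hz =>
    one_sub_conj_mul_ne_zero ha1 (mem_ball_zero_iff.1 (hEm hz))
  have hden' : ∀ w ∈ ball (0 : ℂ) 1, 1 + (starRingEnd ℂ) a * w ≠ 0 := fun w hw => by
    have := one_sub_conj_mul_ne_zero (a := -a) (by rwa [norm_neg]) (mem_ball_zero_iff.1 hw)
    simpa using this
  have hf : DifferentiableOn ℂ f (ball 0 1) :=
    (hE.sub_const a).div ((hE.const_mul _).const_sub 1) hden
  have hfm : MapsTo f (ball 0 1) (ball 0 1) := fun z hz => mem_ball_zero_iff.2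
    (norm_sub_div_one_sub_conj_mul_lt_one ha1 (mem_ball_zero_iff.1 (hEm hz)))
  have hb : DifferentiableOn ℂ b (ball 0 1) :=
    (differentiableOn_id.add_const a).div ((differentiableOn_id.const_mul _).const_add 1) hden'
  have hbm : MapsTo b (ball 0 1) (ball 0 1) := fun w hw => by
    have := norm_sub_div_one_sub_conj_mul_lt_one (a := -a) (by rwa [norm_neg])
      (mem_ball_zero_iff.1 hw)
    simpa [b] using this
  have hf0 : f 0 = 0 := by simp [f, ← ha]
  have hb0 : H (b 0) = 0 := by
    have : b 0 = E 0 := by simp [b, ha]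
    rw [this, hHE h0]
  have hbf : ∀ z ∈ ball (0 : ℂ) 1, b (f z) = E z := by
    intro z hz
    have h1 := hden z hz
    have h2 := hden' _ (hfm hz)
    have h3 : f z * (1 - (starRingEnd ℂ) a * E z) = E z - a := div_mul_cancel₀ _ h1
    refine (div_eq_iff h2).2 ?_
    linear_combination h3
  have hnorm : ∀ z ∈ ball (0 : ℂ) 1, ‖f z‖ = ‖z‖ := by
    intro z hz
    refine le_antisymm (norm_le_norm_of_mapsTo_ball hf
      (hfm.mono_right ball_subset_closedBall) hf0 (mem_ball_zero_iff.1 hz)) ?_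
    have h1 := norm_le_norm_of_mapsTo_ball (f := H ∘ b) (hH.comp hb hbm)
      ((hHm.comp hbm).mono_right ball_subset_closedBall) hb0 (mem_ball_zero_iff.1 (hfm hz))
    rwa [Function.comp_apply, hbf z hz, hHE hz] at h1
  have hhalf : (1 / 2 : ℂ) ∈ ball (0 : ℂ) 1 := by
    rw [mem_ball_zero_iff]
    norm_num
  obtain ⟨u, hu, hfu⟩ := affine_of_mapsTo_ball_of_exists_norm_dslope_eq_div' (R₂ := 1) hf
    (by rw [hf0]; exact hfm.mono_right ball_subset_closedBall)
    ⟨1 / 2, hhalf, by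
      rw [dslope_of_ne _ (by norm_num), slope_def_module, hf0, sub_zero, sub_zero, norm_smul,
        hnorm _ hhalf]
      norm_num⟩
  refine ⟨u, by rwa [div_one] at hu, fun z hz => ?_⟩
  have h1 := hfu hz
  simp only [hf0, sub_zero, zero_add, smul_eq_mul] at h1
  have h2 : E z - a = z * u * (1 - (starRingEnd ℂ) a * E z) := (div_eq_iff (hden z hz)).1 h1
  linear_combination h2

/-- If a Möbius automorphism of the disc maps a circle of radius `1/10` and center of modulus
`1/2` to another such circle, then the image of the origin satisfies a quadratic equation. -/
theorem normSq_eq_of_moebius_circle {a c e : ℂ} (hc : normSq c = 1 / 4) (he : normSq e = 1 / 4)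
    (h : ∀ η : ℂ, ‖η‖ = 1 →
      normSq ((e + 1 / 10 * η) + a - c * (1 + (starRingEnd ℂ) a * (e + 1 / 10 * η))) =
        1 / 100 * normSq (1 + (starRingEnd ℂ) a * (e + 1 / 10 * η))) :
    0.9424 * normSq a = 1.52 * (a.re * c.re + a.im * c.im) := by
  obtain ⟨p, q⟩ := a
  obtain ⟨s, t⟩ := c
  obtain ⟨g, k⟩ := e
  have h1 := h 1 (by simp)
  have h2 := h (-1) (by simp)
  have h3 := h I (by simp)
  have h4 := h (-I) (by simp)
  have hten : (1 / 10 : ℂ) = ((1 / 10 : ℝ) : ℂ) := by push_cast; rfl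
  rw [hten] at h1 h2 h3 h4
  simp only [normSq_apply, add_re, add_im, sub_re, sub_im, mul_re, mul_im, conj_re, conj_im,
    one_re, one_im, neg_re, neg_im, I_re, I_im, ofReal_re, ofReal_im] at h1 h2 h3 h4 hc he ⊢
  obtain ⟨X, hX⟩ : ∃ X, X = (1 - s * p - t * q) ^ 2 + (s * q - t * p) ^ 2
    - 1 / 100 * (p ^ 2 + q ^ 2) := ⟨_, rfl⟩
  obtain ⟨Z, hZ⟩ : ∃ Z, Z = (p - s) ^ 2 + (q - t) ^ 2 - 1 / 100 := ⟨_, rfl⟩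
  obtain ⟨Y, hY⟩ : ∃ Y, Y = (1 - s * p - t * q) * (p - s) + (s * q - t * p) * (q - t)
    - 1 / 100 * p := ⟨_, rfl⟩
  obtain ⟨W, hW⟩ : ∃ W, W = (1 - s * p - t * q) * (q - t) - (s * q - t * p) * (p - s)
    - 1 / 100 * q := ⟨_, rfl⟩
  have k1 : X * ((g + 1 / 10) ^ 2 + k ^ 2) + 2 * (Y * (g + 1 / 10) + W * k) + Z = 0 := by
    rw [hX, hY, hZ, hW]; linear_combination h1
  have k2 : X * ((g - 1 / 10) ^ 2 + k ^ 2) + 2 * (Y * (g - 1 / 10) + W * k) + Z = 0 := by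
    rw [hX, hY, hZ, hW]; linear_combination h2
  have k3 : X * (g ^ 2 + (k + 1 / 10) ^ 2) + 2 * (Y * g + W * (k + 1 / 10)) + Z = 0 := by
    rw [hX, hY, hZ, hW]; linear_combination h3
  have k4 : X * (g ^ 2 + (k - 1 / 10) ^ 2) + 2 * (Y * g + W * (k - 1 / 10)) + Z = 0 := by
    rw [hX, hY, hZ, hW]; linear_combination h4
  have hYX : Y = -(X * g) := by linarith
  have hWX : W = -(X * k) := by linarith
  have hZX : Z = 0.24 * X := by
    rw [hYX, hWX] at k1
    linear_combination k1 + X * he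
  rw [hX, hZ] at hZX
  linear_combination hZX + (0.24 * (p ^ 2 + q ^ 2) - 1) * hc

namespace CircleConfig

variable {F G : ℂ → ℂ}

theorem normSq_fourHoles_center {j : Fin 5} (hj : j ≠ 0) :
    normSq (fourHoles.center j) = 1 / 4 := by
  rw [normSq_eq_norm_sq, norm_fourHoles_center hj]
  norm_num

theorem IsAdmissiblePair.exists_eq_I_pow_mul {σ : Equiv.Perm (Fin 5)} (hσ : σ 0 = 0)
    (h : IsAdmissiblePair fourHoles (fourHoles.permute σ hσ) F G) :
    ∃ k : Fin 4, ∀ z ∈ fourHoles.dom, F z = I ^ (k : ℕ) * z := by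
  obtain ⟨E, H, hEF, hE, hH, hEm, hHm, hHE, -, hEj⟩ := h.exists_extension
  have hR' : (fourHoles.permute σ hσ).outerRadius = 1 := by
    change -(fourHoles.radius (σ 0)) = 1
    rw [hσ]
    exact fourHoles_outerRadius
  have hc' : (fourHoles.permute σ hσ).center 0 = 0 := by
    change fourHoles.center (σ 0) = 0
    rw [hσ, fourHoles_center_outer]
  have hdom := fourHoles.dom_subset_ball
  rw [hR', hc'] at hH hHm hEm
  rw [fourHoles_outerRadius, fourHoles_center_outer] at hE hEm hHm hHE hdom
  have hσj : ∀ {j}, j ≠ 0 → σ j ≠ 0 := fun hj h' => hj (σ.injective (h'.trans hσ.symm))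
  obtain ⟨u, hu, hmob⟩ := exists_mul_eq_of_leftInvOn_ball hE hH hEm hHm hHE
  have hu0 : u ≠ 0 := norm_ne_zero_iff.1 (by rw [hu]; exact one_ne_zero)
  have hcirc : ∀ j, j ≠ 0 → ∀ η : ℂ, ‖η‖ = 1 → ∃ z ∈ ball (0 : ℂ) 1,
      u * z = u * fourHoles.center j + 1 / 10 * η ∧
        ‖E z - fourHoles.center (σ j)‖ = 1 / 10 := by
    intro j hj η hη
    have hz : fourHoles.center j + 1 / 10 * (η / u) ∈
        sphere (fourHoles.center j) (fourHoles.radius j) := by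
      rw [fourHoles_radius hj, mem_sphere, dist_eq_norm, add_sub_cancel_left, norm_mul,
        norm_div η, hη, hu]
      norm_num
    have hzb := fourHoles.closedBall_subset_ball_outer hj (sphere_subset_closedBall hz)
    rw [fourHoles_outerRadius, fourHoles_center_outer] at hzb
    refine ⟨_, hzb, ?_, ?_⟩
    · field_simp
    · have h1 := (hEj j hj).2 hz
      rw [mem_sphere, dist_eq_norm] at h1
      exact h1.trans (fourHoles_radius (hσj hj))
  have hquad : ∀ j, j ≠ 0 → 0.9424 * normSq (E 0) =
      1.52 * ((E 0).re * (fourHoles.center j).re + (E 0).im * (fourHoles.center j).im) := by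
    intro j hj
    obtain ⟨i, rfl⟩ := σ.surjective j
    have hi : i ≠ 0 := fun h' => hj (by rw [h', hσ])
    refine normSq_eq_of_moebius_circle (e := u * fourHoles.center i) (normSq_fourHoles_center hj)
      ?_ fun η hη => ?_
    · rw [normSq_mul, normSq_fourHoles_center hi, normSq_eq_norm_sq, hu]
      norm_num
    · obtain ⟨z, hz, huz, hEz⟩ := hcirc i hi η hη
      rw [← huz, ← hmob z hz, ← sub_mul, normSq_mul, normSq_eq_norm_sq (E z - _), hEz]
      norm_num
  have hE0 : E 0 = 0 := by
    have h1 := hquad 1 (by decide)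
    have h2 := hquad 2 (by decide)
    have e1 : fourHoles.center 1 = 1 / 2 := rfl
    have e2 : fourHoles.center 2 = -1 / 2 := rfl
    rw [← normSq_eq_zero]
    norm_num [e1, e2] at h1 h2
    linarith
  have hEu : ∀ z ∈ ball (0 : ℂ) 1, E z = u * z := fun z hz => by
    simpa [hE0] using hmob z hz
  have h1 : (1 : Fin 5) ≠ 0 := by decide
  obtain ⟨k, hk⟩ := exists_fourHoles_center_eq (hσj h1)
  have hcen : normSq (u * fourHoles.center 1 - fourHoles.center (σ 1)) = 0 := by
    have hcirc' : ∀ η : ℂ, ‖η‖ = 1 →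
        normSq (u * fourHoles.center 1 - fourHoles.center (σ 1) + 1 / 10 * η) = 1 / 100 := by
      intro η hη
      obtain ⟨z, hz, huz, hEz⟩ := hcirc 1 h1 η hη
      rw [hEu z hz, huz, add_sub_right_comm] at hEz
      rw [normSq_eq_norm_sq, hEz]
      norm_num
    have h2 := hcirc' 1 (by simp)
    have h3 := hcirc' (-1) (by simp)
    rw [normSq_add] at h2 h3
    norm_num at h2 h3
    linarith
  refine ⟨k, fun z hz => ?_⟩
  rw [← hEF hz, hEu z (hdom hz)]
  rw [normSq_eq_zero, hk, sub_eq_zero] at hcen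
  have : fourHoles.center 1 = 1 / 2 := rfl
  rw [this] at hcen
  linear_combination 2 * z * hcen

end CircleConfig

theorem mapsTo_I_mul_fourHoleDomain : MapsTo (I * ·) FourHoleDomain FourHoleDomain := by
  intro z hz
  have hI : ∀ w v : ℂ, I * w = v → ‖v‖ = ‖w‖ := fun w v h => by
    rw [← h, norm_mul, norm_I, one_mul]
  have h1 := hI (z - -I / 2) (I * z - 1 / 2) (by linear_combination I_mul_I / 2)
  have h2 := hI (z - I / 2) (I * z - -1 / 2) (by linear_combination -I_mul_I / 2)
  have h3 := hI (z - 1 / 2) (I * z - I / 2) (by ring)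
  have h4 := hI (z - -1 / 2) (I * z - -I / 2) (by ring)
  simp only [FourHoleDomain, Set.mem_sdiff, mem_union, mem_ball, mem_closedBall, dist_eq_norm,
    sub_zero, norm_mul, norm_I, one_mul, h1, h2, h3, h4] at hz ⊢
  tauto

theorem mapsTo_I_pow_mul_fourHoleDomain (n : ℕ) :
    MapsTo (I ^ n * ·) FourHoleDomain FourHoleDomain := by
  induction n with
  | zero => exact fun z hz => by simpa using hz
  | succ n ih =>
    intro z hz
    have := mapsTo_I_mul_fourHoleDomain (ih hz)
    simpa [pow_succ', mul_assoc] using this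

open CircleConfig

/-- The automorphism group of
`D(0,1) \ (cl(D(1/2,1/10)) ∪ cl(D(-1/2,1/10)) ∪ cl(D(i/2,1/10)) ∪ cl(D(-i/2,1/10)))`
consists of exactly the four rotations `z ↦ iᵏ z`, `k ∈ {0,1,2,3}`. -/
theorem fourHoleDomain_automorphisms (φ : ℂ → ℂ) :
    (DifferentiableOn ℂ φ FourHoleDomain ∧
      Set.BijOn φ FourHoleDomain FourHoleDomain) ↔
      ∃ k : Fin 4, ∀ z ∈ FourHoleDomain, φ z = Complex.I ^ (k : ℕ) * z := by
  constructor
  · rintro ⟨hφ, hbij⟩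
    rw [← dom_fourHoles] at hφ hbij ⊢
    have hinv := hbij.invOn_invFunOn
    have hψm : MapsTo (Function.invFunOn φ fourHoles.dom) fourHoles.dom fourHoles.dom :=
      hbij.surjOn.mapsTo_invFunOn
    have hψ := differentiableOn_of_invOn fourHoles.isOpen_dom fourHoles.isOpen_dom hφ hψm
      hinv.1 hinv.2
    obtain ⟨σ, hσ⟩ := exists_perm_tendsto_boundaryEnd hφ.continuousOn hψ.continuousOn
      hbij.mapsTo hψm hinv.1 hinv.2
    by_cases hσ0 : σ 0 = 0
    · exact (isAdmissiblePair_of_outer_eq hφ hψ hbij.mapsTo hψm hinv.1 hinv.2 hσ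
        hσ0).exists_eq_I_pow_mul
    · exact absurd (isAdmissiblePair_of_outer_ne hφ hψ hbij.mapsTo hψm hinv.1 hinv.2 hσ rfl hσ0)
        (not_isAdmissiblePair_fourHoles_invert hσ0 rfl)
  · rintro ⟨k, hk⟩
    have hk' : EqOn (I ^ (k : ℕ) * ·) φ FourHoleDomain := fun z hz => (hk z hz).symm
    refine ⟨(DifferentiableOn.const_mul differentiableOn_id _).congr hk, BijOn.congr ?_ hk'⟩
    have hI : (I ^ (k : ℕ)) ^ 4 = 1 := by rw [← pow_mul, mul_comm, pow_mul, I_pow_four, one_pow]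
    refine InvOn.bijOn (f' := (I ^ ((k : ℕ) * 3) * ·)) ⟨fun z _ => ?_, fun z _ => ?_⟩
      (mapsTo_I_pow_mul_fourHoleDomain _) (mapsTo_I_pow_mul_fourHoleDomain _)
    · simp only [pow_mul]
      linear_combination z * hI
    · simp only [pow_mul]
      linear_combination z * hI
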